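/- arXiv:2203.13047 — 2 statements merged into one kernel-verified Lean document; each statement's English description precedes it below -/
import Mathlib

section
/- Let λ > 0, m be a positive integer, τ ∈ ℝ, −1 ≤ δ < m−1, and a ∈ A^τ_δ(ℝ). Then for every χ ∈ S(ℝ) with χ(0) = 1 the limit lim_{ε→0⁺} ∫_{−∞}^0 e^{±iλx^m} a(x) χ(εx) dx exists, is independent of the choice of χ, and equals the oscillatory integral Os-∫₀^∞ e^{±(−1)^m iλ y^m} a(−y) dy. Consequently the full-line oscillatory integral Os-∫_{−∞}^∞ e^{±iλx^m} a(x) dx := lim_{ε→0⁺} ∫_{−∞}^∞ e^{±iλx^m} a(x) χ(εx) dx exists and equals Os-∫₀^∞ e^{±iλx^m} a(x) dx + Os-∫_{−∞}^0 e^{±iλx^m} a(x) dx. -/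
open MeasureTheory Filter Topology Set

/-- The amplitude class `A^τ_δ(ℝ)`. -/
def AmpClass (τ δ : ℝ) (a : ℝ → ℂ) : Prop :=
  ContDiff ℝ (⊤ : ℕ∞) a ∧ ∀ k : ℕ, ∃ C : ℝ, 0 < C ∧ ∀ x : ℝ,
    ‖iteratedDeriv k a x‖ ≤ C * (1 + x ^ 2) ^ ((τ + δ * k) / 2)

/-- Symbols of order `τ` and type `δ` on the half-line `[1, ∞)`. -/
def IsSymbolOn (δ τ : ℝ) (b : ℝ → ℂ) : Prop :=
  (∀ x : ℝ, 1 ≤ x → ContDiffAt ℝ (⊤ : ℕ∞) b x) ∧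
    ∀ k : ℕ, ∃ C : ℝ, ∀ x : ℝ, 1 ≤ x → ‖iteratedDeriv k b x‖ ≤ C * x ^ (τ + δ * k)

namespace IsSymbolOn

variable {δ τ τ' : ℝ} {b c : ℝ → ℂ}

lemma mono (hb : IsSymbolOn δ τ b) (h : τ ≤ τ') : IsSymbolOn δ τ' b := by
  refine ⟨hb.1, fun k => ?_⟩
  obtain ⟨C, hC⟩ := hb.2 k
  have hC0 : 0 ≤ C := by
    have := (norm_nonneg _).trans (hC 1 le_rfl)
    simpa using this
  refine ⟨C, fun x hx => (hC x hx).trans ?_⟩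
  gcongr

protected lemma deriv (hb : IsSymbolOn δ τ b) : IsSymbolOn δ (τ + δ) (deriv b) := by
  refine ⟨fun x hx => ?_, fun k => ?_⟩
  · have h := hb.1 x hx
    exact h.derivWithin (m := (⊤ : ℕ∞)) (by simp)
  · obtain ⟨C, hC⟩ := hb.2 (k + 1)
    refine ⟨C, fun x hx => ?_⟩
    rw [← iteratedDeriv_succ']
    refine (hC x hx).trans (le_of_eq ?_)
    push_cast
    ring_nf

lemma mul (hb : IsSymbolOn δ τ b) (hc : IsSymbolOn δ τ' c) :
    IsSymbolOn δ (τ + τ') (fun x => b x * c x) := by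
  refine ⟨fun x hx => (hb.1 x hx).mul (hc.1 x hx), fun k => ?_⟩
  choose B hB using hb.2
  choose C hC using hc.2
  refine ⟨∑ i ∈ Finset.range (k + 1), (k.choose i : ℝ) * B i * C (k - i), fun x hx => ?_⟩
  have hx0 : 0 < x := by linarith
  have hle : ∀ n : ℕ, ((n : ℕ∞) : WithTop ℕ∞) ≤ ((⊤ : ℕ∞) : WithTop ℕ∞) := fun n => by
    exact_mod_cast le_top
  have := iteratedDeriv_mul ((hb.1 x hx).of_le (hle k)) ((hc.1 x hx).of_le (hle k))
  change ‖iteratedDeriv k (b * c) x‖ ≤ _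
  rw [this, Finset.sum_mul]
  refine (norm_sum_le _ _).trans (Finset.sum_le_sum fun i hi => ?_)
  have hik : i ≤ k := by simpa [Nat.lt_succ_iff] using hi
  rw [norm_mul, norm_mul, Complex.norm_natCast]
  have hexp : x ^ (τ + τ' + δ * k) = x ^ (τ + δ * i) * x ^ (τ' + δ * (k - i : ℕ)) := by
    rw [← Real.rpow_add hx0, Nat.cast_sub hik]
    ring_nf
  calc (k.choose i : ℝ) * ‖iteratedDeriv i b x‖ * ‖iteratedDeriv (k - i) c x‖
      ≤ (k.choose i : ℝ) * (B i * x ^ (τ + δ * i)) *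
          (C (k - i) * x ^ (τ' + δ * (k - i : ℕ))) := by
        have h1 := hB i x hx
        have h2 := hC (k - i) x hx
        have := (norm_nonneg _).trans h1
        gcongr
    _ = _ := by rw [hexp]; ring

lemma const (z : ℂ) : IsSymbolOn δ 0 (fun _ => z) := by
  refine ⟨fun x _ => contDiffAt_const, fun k => ⟨‖z‖, fun x hx => ?_⟩⟩
  rw [iteratedDeriv_const]
  split_ifs with h
  · simp [h]
  · have : 0 ≤ x := by linarith
    simp only [norm_zero]
    positivity

lemma inv (hδ : -1 ≤ δ) : IsSymbolOn δ (-1) (fun x => (x : ℂ)⁻¹) := by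
  have hd : ∀ x : ℝ, 1 ≤ x → ContDiffAt ℝ (⊤ : ℕ∞) (fun y : ℝ => y⁻¹) x := fun x hx =>
    contDiffAt_inv ℝ (by positivity)
  have heq : (fun x : ℝ => (x : ℂ)⁻¹) = Complex.ofRealLI ∘ fun y : ℝ => y⁻¹ := by
    ext x; simp
  refine ⟨fun x hx => ?_, fun k => ⟨k.factorial, fun x hx => ?_⟩⟩
  · rw [heq]
    exact Complex.ofRealLI.contDiff.contDiffAt.comp x (hd x hx)
  · have hx0 : 0 < x := by linarith
    rw [heq, ← norm_iteratedFDeriv_eq_norm_iteratedDeriv,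
      Complex.ofRealLI.norm_iteratedFDeriv_comp_left (hd x hx) (by exact_mod_cast le_top),
      norm_iteratedFDeriv_eq_norm_iteratedDeriv, iteratedDeriv_eq_iterate]
    change ‖_root_.deriv^[k] Inv.inv x‖ ≤ _
    rw [iter_deriv_inv, norm_mul, norm_mul, norm_pow, norm_neg, norm_one, one_pow, one_mul,
      Real.norm_natCast, Real.norm_of_nonneg (by positivity), ← Real.rpow_intCast]
    gcongr
    push_cast
    nlinarith [Nat.cast_nonneg (α := ℝ) k]

lemma inv_pow (hδ : -1 ≤ δ) (n : ℕ) : IsSymbolOn δ (-n) (fun x => ((x : ℂ)⁻¹) ^ n) := by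
  induction n with
  | zero => simpa using const 1
  | succ n ih =>
    have := ih.mul (inv hδ)
    simp only [← pow_succ] at this
    convert this using 1
    push_cast
    ring

lemma continuousOn (hb : IsSymbolOn δ τ b) : ContinuousOn b (Ioi 1) := fun x hx =>
  (hb.1 x (le_of_lt hx)).continuousAt.continuousWithinAt

lemma norm_le (hb : IsSymbolOn δ τ b) : ∃ C : ℝ, 0 ≤ C ∧ ∀ x : ℝ, 1 ≤ x → ‖b x‖ ≤ C * x ^ τ := by
  obtain ⟨C, hC⟩ := hb.2 0
  simp only [iteratedDeriv_zero, Nat.cast_zero, mul_zero, add_zero] at hC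
  refine ⟨C, ?_, hC⟩
  simpa using (norm_nonneg _).trans (hC 1 le_rfl)

lemma norm_mul_schwartz_le (hb : IsSymbolOn δ τ b) (χ : SchwartzMap ℝ ℂ) {ε : ℝ} (hε : 0 < ε) :
    ∃ C r : ℝ, r < -1 ∧ ∀ x : ℝ, 1 ≤ x → ‖b x * χ (ε * x)‖ ≤ C * x ^ r := by
  obtain ⟨C, hC0, hC⟩ := hb.norm_le
  obtain ⟨K, hK⟩ := exists_nat_gt (τ + 1)
  obtain ⟨D, hD0, hD⟩ := χ.decay K 0
  refine ⟨C * (D / ε ^ K), τ - K, by linarith, fun x hx => ?_⟩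
  have hx0 : 0 < x := by linarith
  have h := hD (ε * x)
  rw [norm_iteratedFDeriv_zero, Real.norm_of_nonneg (by positivity), mul_pow] at h
  have h' : ‖χ (ε * x)‖ ≤ D / (ε ^ K * x ^ K) := by
    rw [le_div_iff₀ (by positivity)]
    linarith
  rw [norm_mul, Real.rpow_sub hx0, Real.rpow_natCast]
  calc ‖b x‖ * ‖χ (ε * x)‖ ≤ (C * x ^ τ) * (D / (ε ^ K * x ^ K)) := by
        have := hC x hx
        gcongr
    _ = _ := by field_simp

end IsSymbolOn

lemma norm_cexp_mul_ofReal {κ : ℂ} (hκ : κ.re = 0) (x : ℝ) : ‖Complex.exp (κ * (x : ℂ))‖ = 1 := by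
  rw [Complex.norm_exp]
  simp [hκ]

lemma AmpClass.isSymbolOn {τ δ : ℝ} {a : ℝ → ℂ} (ha : AmpClass τ δ a) : IsSymbolOn δ τ a := by
  refine ⟨fun x _ => ha.1.contDiffAt, fun k => ?_⟩
  obtain ⟨C, hC0, hC⟩ := ha.2 k
  set σ := τ + δ * k
  refine ⟨C * (2 ^ (σ / 2) + 1), fun x hx => (hC x).trans ?_⟩
  have hx0 : 0 < x := by linarith
  have hsq : (x ^ 2) ^ (σ / 2) = x ^ σ := by
    rw [← Real.rpow_natCast, ← Real.rpow_mul hx0.le]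
    congr 1
    push_cast
    ring
  rw [mul_assoc]
  gcongr
  rcases le_total 0 σ with h | h
  · calc (1 + x ^ 2) ^ (σ / 2) ≤ (2 * x ^ 2) ^ (σ / 2) := by
          gcongr
          nlinarith
      _ = 2 ^ (σ / 2) * x ^ σ := by rw [Real.mul_rpow (by norm_num) (by positivity), hsq]
      _ ≤ _ := by
          gcongr
          linarith
  · calc (1 + x ^ 2) ^ (σ / 2) ≤ (x ^ 2) ^ (σ / 2) :=
          Real.rpow_le_rpow_of_nonpos (by positivity) (by linarith) (by linarith)
      _ = 1 * x ^ σ := by rw [hsq, one_mul]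
      _ ≤ _ := by
          gcongr
          have : (0 : ℝ) < 2 ^ (σ / 2) := by positivity
          linarith

lemma AmpClass.comp_neg {τ δ : ℝ} {a : ℝ → ℂ} (ha : AmpClass τ δ a) :
    AmpClass τ δ (fun x => a (-x)) := by
  refine ⟨ha.1.comp contDiff_neg, fun k => ?_⟩
  obtain ⟨C, hC0, hC⟩ := ha.2 k
  refine ⟨C, hC0, fun x => ?_⟩
  rw [iteratedDeriv_comp_neg, norm_smul, norm_pow, norm_neg, norm_one, one_pow, one_mul]
  simpa using hC (-x)

/-- The Schwartz function `t ↦ t * χ' t`. -/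
noncomputable def SchwartzMap.eulerDeriv (χ : SchwartzMap ℝ ℂ) : SchwartzMap ℝ ℂ :=
  SchwartzMap.smulLeftCLM ℂ (fun t : ℝ => t) (SchwartzMap.derivCLM ℝ ℂ χ)

lemma SchwartzMap.eulerDeriv_apply (χ : SchwartzMap ℝ ℂ) (t : ℝ) :
    χ.eulerDeriv t = t * deriv χ t := by
  rw [SchwartzMap.eulerDeriv, SchwartzMap.smulLeftCLM_apply_apply (by fun_prop),
    SchwartzMap.derivCLM_apply, Complex.real_smul]

section OscillatoryIntegral

variable {κ : ℂ} {δ τ : ℝ} {b : ℝ → ℂ}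

lemma continuous_phase (κ : ℂ) (m : ℕ) :
    Continuous fun y : ℝ => Complex.exp (κ * ((y ^ m : ℝ) : ℂ)) := by
  fun_prop

lemma continuous_schwartz_scale (χ : SchwartzMap ℝ ℂ) (ε : ℝ) :
    Continuous fun y : ℝ => χ (ε * y) :=
  χ.continuous.comp (continuous_const.mul continuous_id)

lemma tendsto_schwartz_scale (χ : SchwartzMap ℝ ℂ) (y : ℝ) :
    Tendsto (fun ε : ℝ => χ (ε * y)) (𝓝[>] 0) (𝓝 (χ 0)) := by
  have h : Continuous fun ε : ℝ => χ (ε * y) :=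
    χ.continuous.comp (continuous_id.mul continuous_const)
  have h0 := h.tendsto 0
  rw [zero_mul] at h0
  exact h0.mono_left nhdsWithin_le_nhds

lemma IsSymbolOn.integrableOn_Ioi_one (hb : IsSymbolOn δ τ b) (hκ : κ.re = 0) (m : ℕ)
    (χ : SchwartzMap ℝ ℂ) {ε : ℝ} (hε : 0 < ε) :
    IntegrableOn (fun y : ℝ => Complex.exp (κ * ((y ^ m : ℝ) : ℂ)) * b y * χ (ε * y)) (Ioi 1) := by
  obtain ⟨C, r, hr, hC⟩ := hb.norm_mul_schwartz_le χ hε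
  refine Integrable.mono' ((integrableOn_Ioi_rpow_of_lt hr one_pos).const_mul C) ?_ ?_
  · exact ((((continuous_phase κ m).continuousOn).mul hb.continuousOn).mul
      (continuous_schwartz_scale χ ε).continuousOn).aestronglyMeasurable measurableSet_Ioi
  · refine (ae_restrict_iff' measurableSet_Ioi).2 (ae_of_all _ fun y hy => ?_)
    rw [mul_assoc, norm_mul, norm_cexp_mul_ofReal hκ, one_mul]
    exact hC y (le_of_lt hy)

lemma IsSymbolOn.tendsto_mul_schwartz_atTop (hb : IsSymbolOn δ τ b) (hκ : κ.re = 0) (m : ℕ)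
    (χ : SchwartzMap ℝ ℂ) {ε : ℝ} (hε : 0 < ε) :
    Tendsto (fun y : ℝ => Complex.exp (κ * ((y ^ m : ℝ) : ℂ)) * b y * χ (ε * y)) atTop (𝓝 0) := by
  obtain ⟨C, r, hr, hC⟩ := hb.norm_mul_schwartz_le χ hε
  have h0 : Tendsto (fun y : ℝ => C * y ^ r) atTop (𝓝 0) := by
    have := (tendsto_rpow_neg_atTop (y := -r) (by linarith)).const_mul C
    simpa using this
  refine squeeze_zero_norm' ?_ h0
  filter_upwards [eventually_ge_atTop 1] with y hy
  rw [mul_assoc, norm_mul, norm_cexp_mul_ofReal hκ, one_mul]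
  exact hC y hy

/-- Regularization of an integral by a scaled Schwartz cutoff, for an integrable amplitude. -/
lemma tendsto_integral_mul_schwartz_scale {f : ℝ → ℂ} {s : Set ℝ} (hf : IntegrableOn f s)
    (χ : SchwartzMap ℝ ℂ) :
    Tendsto (fun ε : ℝ => ∫ y in s, f y * χ (ε * y)) (𝓝[>] 0) (𝓝 (χ 0 * ∫ y in s, f y)) := by
  obtain ⟨D, hD0, hD⟩ := χ.decay 0 0
  simp only [pow_zero, one_mul, norm_iteratedFDeriv_zero] at hD
  rw [mul_comm, ← integral_mul_const]
  refine tendsto_integral_filter_of_dominated_convergence (fun y => ‖f y‖ * D) ?_ ?_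
    (hf.norm.mul_const D) ?_
  · exact Eventually.of_forall fun ε =>
      hf.aestronglyMeasurable.mul (continuous_schwartz_scale χ ε).aestronglyMeasurable
  · refine Eventually.of_forall fun ε => ae_of_all _ fun y => ?_
    rw [norm_mul]
    exact mul_le_mul_of_nonneg_left (hD _) (norm_nonneg _)
  · exact ae_of_all _ fun y => (tendsto_schwartz_scale χ y).const_mul (f y)

/-- One integration by parts against the phase `exp (κ y ^ (n + 1))` on `[1, ∞)`. -/
lemma IsSymbolOn.integral_Ioi_one_eq (hb : IsSymbolOn δ τ b) (hδ : -1 ≤ δ) (hκ : κ.re = 0)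
    (hκ0 : κ ≠ 0) (n : ℕ) {c : ℝ → ℂ}
    (hc : c = fun x => (κ * (n + 1))⁻¹ * (b x * ((x : ℂ)⁻¹) ^ n)) (χ : SchwartzMap ℝ ℂ) {ε : ℝ}
    (hε : 0 < ε) :
    ∫ y in Ioi (1 : ℝ), Complex.exp (κ * ((y ^ (n + 1) : ℝ) : ℂ)) * b y * χ (ε * y) =
      -(Complex.exp κ * c 1 * χ (ε * 1)) -
        (∫ y in Ioi (1 : ℝ), Complex.exp (κ * ((y ^ (n + 1) : ℝ) : ℂ)) * deriv c y * χ (ε * y)) -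
        ∫ y in Ioi (1 : ℝ), Complex.exp (κ * ((y ^ (n + 1) : ℝ) : ℂ)) * (c y * (y : ℂ)⁻¹) *
          χ.eulerDeriv (ε * y) := by
  have hcs : IsSymbolOn δ (0 + (τ + -n)) c := by
    rw [hc]
    exact (const _).mul (hb.mul (inv_pow hδ n))
  have i0 := hb.integrableOn_Ioi_one hκ (n + 1) χ hε
  have i1 := hcs.deriv.integrableOn_Ioi_one hκ (n + 1) χ hε
  have i2 := (hcs.mul (inv hδ)).integrableOn_Ioi_one hκ (n + 1) χ.eulerDeriv hε
  have hF : ∀ x ∈ Ici (1 : ℝ), HasDerivAt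
      (fun y : ℝ => Complex.exp (κ * ((y ^ (n + 1) : ℝ) : ℂ)) * c y * χ (ε * y))
      (Complex.exp (κ * ((x ^ (n + 1) : ℝ) : ℂ)) * b x * χ (ε * x) +
        Complex.exp (κ * ((x ^ (n + 1) : ℝ) : ℂ)) * deriv c x * χ (ε * x) +
        Complex.exp (κ * ((x ^ (n + 1) : ℝ) : ℂ)) * (c x * (x : ℂ)⁻¹) * χ.eulerDeriv (ε * x))
      x := by
    intro x hx
    have hx0 : (x : ℂ) ≠ 0 := by
      have : (0 : ℝ) < x := lt_of_lt_of_le one_pos hx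
      exact_mod_cast this.ne'
    have hn : (n + 1 : ℂ) ≠ 0 := by exact_mod_cast n.succ_ne_zero
    have d1 : HasDerivAt (fun y : ℝ => Complex.exp (κ * ((y ^ (n + 1) : ℝ) : ℂ)))
        (Complex.exp (κ * ((x ^ (n + 1) : ℝ) : ℂ)) *
          (κ * (((n + 1 : ℕ) * x ^ n : ℝ) : ℂ))) x := by
      have := (hasDerivAt_pow (n + 1) x).ofReal_comp.const_mul κ
      simpa using this.cexp
    have d2 : HasDerivAt c (deriv c x) x :=
      ((hcs.1 x hx).differentiableAt (by simp)).hasDerivAt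
    have d3 : HasDerivAt (fun y : ℝ => χ (ε * y)) (ε * deriv χ (ε * x)) x := by
      have h1 : HasDerivAt (fun y : ℝ => ε * y) ε x := by
        simpa using (hasDerivAt_id x).const_mul ε
      have := (χ.differentiableAt (x := ε * x)).hasDerivAt.scomp x h1
      rwa [Complex.real_smul] at this
    refine ((d1.mul d2).mul d3).congr_deriv ?_
    have hcx : b x = κ * (n + 1) * (x : ℂ) ^ n * c x := by
      simp only [hc, _root_.inv_pow]
      field_simp
    rw [SchwartzMap.eulerDeriv_apply, hcx]
    simp only [Pi.mul_apply]
    push_cast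
    field_simp
  have key := integral_Ioi_of_hasDerivAt_of_tendsto' hF ((i0.add i1).add i2)
    (hcs.tendsto_mul_schwartz_atTop hκ (n + 1) χ hε)
  have e1 := integral_add (i0.add i1) i2
  have e2 := integral_add i0 i1
  simp only [Pi.add_apply] at e1 e2
  rw [e1, e2] at key
  simp only [one_pow, Complex.ofReal_one, mul_one, zero_sub] at key ⊢
  linear_combination key

lemma IsSymbolOn.exists_tendsto_integral_Ioi_one (hδ : -1 ≤ δ) (hκ : κ.re = 0) (hκ0 : κ ≠ 0)
    (n : ℕ) (hn : δ < n) (hb : IsSymbolOn δ τ b) :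
    ∃ I : ℂ, ∀ χ : SchwartzMap ℝ ℂ, Tendsto
      (fun ε : ℝ => ∫ y in Ioi (1 : ℝ),
        Complex.exp (κ * ((y ^ (n + 1) : ℝ) : ℂ)) * b y * χ (ε * y))
      (𝓝[>] 0) (𝓝 (χ 0 * I)) := by
  obtain ⟨N, hN⟩ := exists_nat_gt ((τ + 1) / (n - δ))
  rw [div_lt_iff₀ (by linarith)] at hN
  induction N generalizing τ b with
  | zero =>
    obtain ⟨C, hC0, hC⟩ := hb.norm_le
    have hint : IntegrableOn (fun y : ℝ => Complex.exp (κ * ((y ^ (n + 1) : ℝ) : ℂ)) * b y)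
        (Ioi 1) := by
      have hτ : τ < -1 := by
        rw [Nat.cast_zero, zero_mul] at hN
        linarith
      refine Integrable.mono' ((integrableOn_Ioi_rpow_of_lt hτ one_pos).const_mul C) ?_ ?_
      · exact ((continuous_phase κ (n + 1)).continuousOn.mul hb.continuousOn).aestronglyMeasurable
          measurableSet_Ioi
      · refine (ae_restrict_iff' measurableSet_Ioi).2 (ae_of_all _ fun y hy => ?_)
        rw [norm_mul, norm_cexp_mul_ofReal hκ, one_mul]
        exact hC y (le_of_lt hy)
    exact ⟨_, tendsto_integral_mul_schwartz_scale hint⟩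
  | succ N ih =>
    set c : ℝ → ℂ := fun x => (κ * (n + 1))⁻¹ * (b x * ((x : ℂ)⁻¹) ^ n) with hc
    have hcs : IsSymbolOn δ (0 + (τ + -n)) c := (const _).mul (hb.mul (inv_pow hδ n))
    have hord : τ - n + δ + 1 < N * (n - δ) := by
      push_cast at hN
      linarith
    obtain ⟨I₁, h₁⟩ := ih (hcs.deriv.mono (τ' := τ - n + δ) (by linarith)) hord
    obtain ⟨I₂, h₂⟩ := ih ((hcs.mul (inv hδ)).mono (τ' := τ - n + δ) (by linarith)) hord
    refine ⟨-(Complex.exp κ * c 1) - I₁, fun χ => ?_⟩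
    have hlim := (((tendsto_schwartz_scale χ 1).const_mul (Complex.exp κ * c 1)).neg.sub
      (h₁ χ)).sub (h₂ χ.eulerDeriv)
    refine (hlim.congr' ?_).trans (le_of_eq ?_)
    · filter_upwards [self_mem_nhdsWithin] with ε hε
      exact (hb.integral_Ioi_one_eq hδ hκ hκ0 n hc χ hε).symm
    · rw [SchwartzMap.eulerDeriv_apply]
      congr 1
      push_cast
      ring

lemma AmpClass.integrableOn_Ioi_zero (hb : AmpClass τ δ b) (hκ : κ.re = 0) (m : ℕ)
    (χ : SchwartzMap ℝ ℂ) {ε : ℝ} (hε : 0 < ε) :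
    IntegrableOn (fun y : ℝ => Complex.exp (κ * ((y ^ m : ℝ) : ℂ)) * b y * χ (ε * y)) (Ioi 0) := by
  rw [← Ioc_union_Ioi_eq_Ioi (zero_le_one' ℝ)]
  refine IntegrableOn.union ?_ (hb.isSymbolOn.integrableOn_Ioi_one hκ m χ hε)
  exact (((continuous_phase κ m).mul hb.1.continuous).mul
    (continuous_schwartz_scale χ ε)).integrableOn_Ioc

/-- Existence of the oscillatory integral over `[0, ∞)`, independently of the cutoff. -/
lemma AmpClass.exists_tendsto_integral_Ioi_zero (hδ : -1 ≤ δ) (hκ : κ.re = 0) (hκ0 : κ ≠ 0)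
    {m : ℕ} (hm : 1 ≤ m) (hδm : δ < (m : ℝ) - 1) (hb : AmpClass τ δ b) :
    ∃ I : ℂ, ∀ χ : SchwartzMap ℝ ℂ, χ 0 = 1 → Tendsto
      (fun ε : ℝ => ∫ y in Ioi (0 : ℝ), Complex.exp (κ * ((y ^ m : ℝ) : ℂ)) * b y * χ (ε * y))
      (𝓝[>] 0) (𝓝 I) := by
  obtain ⟨n, rfl⟩ := Nat.exists_eq_add_of_le' hm
  obtain ⟨I, hI⟩ := hb.isSymbolOn.exists_tendsto_integral_Ioi_one hδ hκ hκ0 n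
    (by push_cast at hδm; linarith)
  have hint : IntegrableOn (fun y : ℝ => Complex.exp (κ * ((y ^ (n + 1) : ℝ) : ℂ)) * b y)
      (Ioc 0 1) := ((continuous_phase κ (n + 1)).mul hb.1.continuous).integrableOn_Ioc
  refine ⟨(∫ y in Ioc (0 : ℝ) 1, Complex.exp (κ * ((y ^ (n + 1) : ℝ) : ℂ)) * b y) + I,
    fun χ hχ => ?_⟩
  have h := (tendsto_integral_mul_schwartz_scale hint χ).add (hI χ)
  rw [hχ, one_mul, one_mul] at h
  refine h.congr' ?_
  filter_upwards [self_mem_nhdsWithin] with ε hε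
  have hi := hb.integrableOn_Ioi_zero hκ (n + 1) χ hε
  rw [← Ioc_union_Ioi_eq_Ioi (zero_le_one' ℝ)] at hi ⊢
  exact (setIntegral_union (Ioc_disjoint_Ioi le_rfl) measurableSet_Ioi hi.left_of_union
    hi.right_of_union).symm

end OscillatoryIntegral

/-- **Reduction of the oscillatory integral on `(-∞,0]` to one on `[0,∞)` and the
decomposition of the full-line oscillatory integral** (double signs in the same order,
encoded by `s = ±1`): the limit defining `Os-∫_{-∞}^0 e^{±iλx^m} a(x) dx` exists,
is independent of `χ`, and coincides with `Os-∫₀^∞ e^{±(-1)^m iλy^m} a(-y) dy`;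
the full-line oscillatory integral exists and is the sum of the two half-line ones. -/
theorem oscillatory_negative_halfline (lam : ℝ) (hlam : 0 < lam) (m : ℕ) (hm : 1 ≤ m)
    (τ δ : ℝ) (hδ₁ : -1 ≤ δ) (hδ₂ : δ < (m : ℝ) - 1) (a : ℝ → ℂ) (ha : AmpClass τ δ a)
    (s : ℝ) (hs : s = 1 ∨ s = -1) :
    ∃ Ineg Ipos Itot : ℂ,
      (∀ χ : SchwartzMap ℝ ℂ, χ 0 = 1 →
        Tendsto
          (fun ε : ℝ => ∫ y in Set.Ioi (0 : ℝ),
            Complex.exp ((s * (-1) ^ m : ℝ) * Complex.I * lam * ((y ^ m : ℝ) : ℂ)) *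
              a (-y) * χ (ε * y))
          (𝓝[>] (0 : ℝ)) (𝓝 Ineg)) ∧
      (∀ χ : SchwartzMap ℝ ℂ, χ 0 = 1 →
        Tendsto
          (fun ε : ℝ => ∫ x in Set.Iio (0 : ℝ),
            Complex.exp (s * Complex.I * lam * ((x ^ m : ℝ) : ℂ)) * a x * χ (ε * x))
          (𝓝[>] (0 : ℝ)) (𝓝 Ineg)) ∧
      (∀ χ : SchwartzMap ℝ ℂ, χ 0 = 1 →
        Tendsto
          (fun ε : ℝ => ∫ x in Set.Ioi (0 : ℝ),
            Complex.exp (s * Complex.I * lam * ((x ^ m : ℝ) : ℂ)) * a x * χ (ε * x))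
          (𝓝[>] (0 : ℝ)) (𝓝 Ipos)) ∧
      (∀ χ : SchwartzMap ℝ ℂ, χ 0 = 1 →
        Tendsto
          (fun ε : ℝ => ∫ x : ℝ,
            Complex.exp (s * Complex.I * lam * ((x ^ m : ℝ) : ℂ)) * a x * χ (ε * x))
          (𝓝[>] (0 : ℝ)) (𝓝 Itot)) ∧
      Itot = Ipos + Ineg := by
  have hs0 : s ≠ 0 := by rcases hs with rfl | rfl <;> norm_num
  set κ : ℂ := s * Complex.I * lam with hκdef
  set κ' : ℂ := (s * (-1) ^ m : ℝ) * Complex.I * lam with hκ'def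
  have hκ : κ.re = 0 := by simp [hκdef]
  have hκ' : κ'.re = 0 := by
    rw [hκ'def]
    simp only [Complex.mul_re, Complex.mul_im, Complex.ofReal_re, Complex.ofReal_im, Complex.I_re,
      Complex.I_im]
    ring
  have hκ0 : κ ≠ 0 := by simp [hκdef, hs0, hlam.ne']
  have hκ0' : κ' ≠ 0 := by simp [hκ'def, hs0, hlam.ne']
  obtain ⟨Ineg, hneg⟩ := ha.comp_neg.exists_tendsto_integral_Ioi_zero hδ₁ hκ' hκ0' hm hδ₂
  obtain ⟨Ipos, hpos⟩ := ha.exists_tendsto_integral_Ioi_zero hδ₁ hκ hκ0 hm hδ₂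
  let reflect : SchwartzMap ℝ ℂ → SchwartzMap ℝ ℂ :=
    SchwartzMap.compCLMOfContinuousLinearEquiv ℝ (ContinuousLinearEquiv.neg ℝ)
  have hrefl : ∀ (χ : SchwartzMap ℝ ℂ) (t : ℝ), reflect χ t = χ (-t) := fun χ t => rfl
  have hphase : ∀ y : ℝ, κ * (((-y) ^ m : ℝ) : ℂ) = κ' * ((y ^ m : ℝ) : ℂ) := fun y => by
    rw [hκdef, hκ'def, neg_pow]
    push_cast
    ring
  have hcomp : ∀ (χ : SchwartzMap ℝ ℂ) (ε y : ℝ),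
      Complex.exp (κ * (((-y) ^ m : ℝ) : ℂ)) * a (-y) * χ (ε * -y) =
        Complex.exp (κ' * ((y ^ m : ℝ) : ℂ)) * a (-y) * reflect χ (ε * y) := fun χ ε y => by
    rw [hphase, hrefl, mul_neg]
  have hIio : ∀ χ : SchwartzMap ℝ ℂ, χ 0 = 1 → Tendsto
      (fun ε : ℝ => ∫ x in Iio (0 : ℝ), Complex.exp (κ * ((x ^ m : ℝ) : ℂ)) * a x * χ (ε * x))
      (𝓝[>] 0) (𝓝 Ineg) := fun χ hχ => by
    refine (hneg (reflect χ) (by rw [hrefl, neg_zero, hχ])).congr fun ε => ?_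
    rw [← integral_Iic_eq_integral_Iio]
    have h := integral_comp_neg_Ioi 0
      (fun x : ℝ => Complex.exp (κ * ((x ^ m : ℝ) : ℂ)) * a x * χ (ε * x))
    rw [neg_zero] at h
    simp only [hcomp] at h
    exact h
  refine ⟨Ineg, Ipos, Ipos + Ineg, hneg, hIio, hpos, fun χ hχ => ?_, rfl⟩
  refine ((hpos χ hχ).add (hIio χ hχ)).congr' ?_
  filter_upwards [self_mem_nhdsWithin] with ε hε
  have i1 := ha.integrableOn_Ioi_zero hκ m χ hε
  have i2 : IntegrableOn
      (fun x : ℝ => Complex.exp (κ * ((x ^ m : ℝ) : ℂ)) * a x * χ (ε * x)) (Iio 0) := by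
    have h := ha.comp_neg.integrableOn_Ioi_zero hκ' m (reflect χ) hε
    simp only [← hcomp] at h
    simpa using h.comp_neg
  rw [← integral_Iic_eq_integral_Iio, add_comm]
  exact intervalIntegral.integral_Iic_add_Ioi
    ((integrableOn_Iic_iff_integrableOn_Iio enorm_ne_top).2 i2) i1
end

section
/- Let n be a positive integer, p = (p₁,…,p_n) with each p_j > 0, and a ∈ C₀^∞(ℝⁿ). For each j fix a sign ±_j ∈ {+,−}, and for multi-indices α = (α₁,…,α_n) ∈ ℤ_{≥0}^n set Ĩ^{±_j}_{p_j,α_j+1} := p_j^{−1} e^{±_j iπ(α_j+1)/(2p_j)} Γ((α_j+1)/p_j) and Ω_p^N := { α ∈ ℤ_{≥0}^n : Σ_{j=1}^n (α_j+1)/p_j < (N+1−max_j(p_j−[p_j]))/max_j p_j }. Then for every positive integer N, ∫_{(0,∞)^n} e^{iλ Σ_{j=1}^n ±_j x_j^{p_j}} a(x) dx = Σ_{α ∈ Ω_p^N} ∏_{j=1}^n Ĩ^{±_j}_{p_j,α_j+1} · (∂^α a(0)/α!) · λ^{−Σ_{j=1}^n (α_j+1)/p_j} + O( λ^{−(N+1−max_j(p_j−[p_j]))/max_j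 p_j} ) as λ → ∞. -/
open MeasureTheory Filter Topology Set

/-- The partial derivative in the `j`-th coordinate direction. -/
noncomputable def pderiv {n : ℕ} (j : Fin n) (g : (Fin n → ℝ) → ℂ) : (Fin n → ℝ) → ℂ :=
  fun x => deriv (fun t : ℝ => g (Function.update x j t)) (x j)

/-- The iterated partial derivative `∂^α = ∂^{α 0}_{x 0} ⋯ ∂^{α (n-1)}_{x (n-1)}`. -/
noncomputable def multiDeriv {n : ℕ} (α : Fin n → ℕ) (g : (Fin n → ℝ) → ℂ) :
    (Fin n → ℝ) → ℂ :=
  ((List.finRange n).foldr (fun j G => (pderiv j)^[α j] ∘ G) id) g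

/-- A symbol estimate of order `m` on the positive half-line, with `L` derivatives. -/
def SymbolBound : ℕ → ℝ → ℝ → (ℝ → ℂ) → Prop
  | 0, m, C, g => ContinuousOn g (Ioi 0) ∧ ∀ x, 0 < x → ‖g x‖ ≤ C * x ^ m
  | L + 1, m, C, g => (∀ x, 0 < x → ‖g x‖ ≤ C * x ^ m) ∧
      ∃ g' : ℝ → ℂ, (∀ x, 0 < x → HasDerivAt g (g' x) x) ∧ SymbolBound L (m - 1) C g'

namespace SymbolBound

variable {L : ℕ} {m C : ℝ} {g : ℝ → ℂ}

lemma norm_le (h : SymbolBound L m C g) {x : ℝ} (hx : 0 < x) : ‖g x‖ ≤ C * x ^ m := by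
  cases L with
  | zero => exact h.2 x hx
  | succ L => exact h.1 x hx

lemma nonneg (h : SymbolBound L m C g) : 0 ≤ C := by
  simpa using (norm_nonneg _).trans (h.norm_le one_pos)

lemma continuousOn (h : SymbolBound L m C g) : ContinuousOn g (Ioi 0) := by
  cases L with
  | zero => exact h.1
  | succ L =>
    obtain ⟨-, g', hg', -⟩ := h
    exact fun x hx => (hg' x hx).continuousAt.continuousWithinAt

lemma mono {C' : ℝ} (hC : C ≤ C') (h : SymbolBound L m C g) : SymbolBound L m C' g := by
  induction L generalizing m g with
  | zero => exact ⟨h.1, fun x hx => (h.2 x hx).trans (by gcongr)⟩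
  | succ L ih =>
    obtain ⟨h1, g', h2, h3⟩ := h
    exact ⟨fun x hx => (h1 x hx).trans (by gcongr), g', h2, ih h3⟩

lemma of_succ (h : SymbolBound (L + 1) m C g) : SymbolBound L m C g := by
  induction L generalizing m g with
  | zero => exact ⟨h.continuousOn, h.1⟩
  | succ L ih =>
    obtain ⟨h1, g', h2, h3⟩ := h
    exact ⟨h1, g', h2, ih h3⟩

lemma add {C' : ℝ} {g₂ : ℝ → ℂ} (h : SymbolBound L m C g) (h' : SymbolBound L m C' g₂) :
    SymbolBound L m (C + C') (fun x => g x + g₂ x) := by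
  induction L generalizing m g g₂ with
  | zero =>
    exact ⟨h.1.add h'.1, fun x hx => (norm_add_le _ _).trans
      ((add_le_add (h.2 x hx) (h'.2 x hx)).trans_eq (by ring))⟩
  | succ L ih =>
    obtain ⟨h1, k, h2, h3⟩ := h
    obtain ⟨h1', k', h2', h3'⟩ := h'
    exact ⟨fun x hx => (norm_add_le _ _).trans
      ((add_le_add (h1 x hx) (h1' x hx)).trans_eq (by ring)), _,
      fun x hx => (h2 x hx).add (h2' x hx), ih h3 h3'⟩

lemma const_smul (c : ℝ) (h : SymbolBound L m C g) :
    SymbolBound L m (|c| * C) (fun x => c • g x) := by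
  induction L generalizing m g with
  | zero =>
    refine ⟨h.1.const_smul c, fun x hx => ?_⟩
    rw [norm_smul, Real.norm_eq_abs, mul_assoc]
    exact mul_le_mul_of_nonneg_left (h.2 x hx) (abs_nonneg c)
  | succ L ih =>
    obtain ⟨h1, g', h2, h3⟩ := h
    refine ⟨fun x hx => ?_, _, fun x hx => (h2 x hx).const_smul c, ih h3⟩
    rw [norm_smul, Real.norm_eq_abs, mul_assoc]
    exact mul_le_mul_of_nonneg_left (h1 x hx) (abs_nonneg c)

lemma norm_rpow_smul_le (h : SymbolBound L m C g) (r : ℝ) {x : ℝ} (hx : 0 < x) :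
    ‖x ^ r • g x‖ ≤ C * x ^ (m + r) := by
  rw [norm_smul, Real.norm_of_nonneg (Real.rpow_nonneg hx.le _), Real.rpow_add hx]
  calc x ^ r * ‖g x‖ ≤ x ^ r * (C * x ^ m) := by gcongr; exact h.norm_le hx
    _ = _ := by ring

lemma exists_rpow_smul (L : ℕ) (m r : ℝ) : ∃ A : ℝ, 1 ≤ A ∧ ∀ (C : ℝ) (g : ℝ → ℂ),
    SymbolBound L m C g → SymbolBound L (m + r) (A * C) (fun x => x ^ r • g x) := by
  induction L generalizing m r with
  | zero =>
    refine ⟨1, le_rfl, fun C g h => ⟨?_, fun x hx => by simpa using h.norm_rpow_smul_le r hx⟩⟩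
    exact (continuousOn_id.rpow_const fun x hx => Or.inl (ne_of_gt hx)).smul h.1
  | succ L ih =>
    obtain ⟨A₁, hA₁, H₁⟩ := ih (m - 1) r
    obtain ⟨A₂, hA₂, H₂⟩ := ih m (r - 1)
    have hr : 0 ≤ |r| * A₂ := by positivity
    refine ⟨A₁ + |r| * A₂, by linarith, fun C g h => ?_⟩
    have hC := h.nonneg
    refine ⟨fun x hx => (h.norm_rpow_smul_le r hx).trans ?_, ?_⟩
    · have : 0 ≤ x ^ (m + r) := Real.rpow_nonneg hx.le _
      gcongr
      nlinarith
    · have hlow := h.of_succ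
      obtain ⟨-, g', h2, h3⟩ := h
      refine ⟨fun x => x ^ r • g' x + r • (x ^ (r - 1) • g x), fun x hx => ?_, ?_⟩
      · refine ((Real.hasDerivAt_rpow_const (p := r) (Or.inl hx.ne')).smul
          (h2 x hx)).congr_deriv ?_
        simp only [smul_smul]
      · have e1 := H₁ C g' h3
        have e2 := (H₂ C g hlow).const_smul r
        rw [show m + (r - 1) = m + r - 1 by ring] at e2
        rw [show m - 1 + r = m + r - 1 by ring] at e1
        rw [show (A₁ + |r| * A₂) * C = A₁ * C + |r| * (A₂ * C) by ring]
        exact e1.add e2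

lemma exists_comp_rpow (L : ℕ) (m r : ℝ) : ∃ A : ℝ, 1 ≤ A ∧ ∀ (C : ℝ) (g : ℝ → ℂ),
    SymbolBound L m C g → SymbolBound L (m * r) (A * C) (fun x => g (x ^ r)) := by
  have hb : ∀ (L : ℕ) (m C : ℝ) (g : ℝ → ℂ), SymbolBound L m C g → ∀ x : ℝ, 0 < x →
      ‖g (x ^ r)‖ ≤ C * x ^ (m * r) := fun L m C g h x hx => by
    have := h.norm_le (Real.rpow_pos_of_pos hx r)
    rwa [← Real.rpow_mul hx.le, mul_comm r m] at this
  induction L generalizing m with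
  | zero =>
    refine ⟨1, le_rfl, fun C g h => ⟨?_, fun x hx => by simpa using hb 0 m C g h x hx⟩⟩
    exact h.1.comp (continuousOn_id.rpow_const fun x hx => Or.inl (ne_of_gt hx))
      fun x hx => Real.rpow_pos_of_pos hx r
  | succ L ih =>
    obtain ⟨A₁, hA₁, H₁⟩ := ih (m - 1)
    obtain ⟨A₂, hA₂, H₂⟩ := exists_rpow_smul L ((m - 1) * r) (r - 1)
    have hr : 0 ≤ |r| * (A₂ * A₁) := by positivity
    refine ⟨1 + |r| * (A₂ * A₁), by linarith, fun C g h => ?_⟩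
    have hC := h.nonneg
    refine ⟨fun x hx => (hb _ _ _ _ h x hx).trans ?_, ?_⟩
    · have : 0 ≤ x ^ (m * r) := Real.rpow_nonneg hx.le _
      gcongr
      nlinarith
    · obtain ⟨-, g', h2, h3⟩ := h
      refine ⟨fun x => r • (x ^ (r - 1) • g' (x ^ r)), fun x hx => ?_, ?_⟩
      · have := (h2 _ (Real.rpow_pos_of_pos hx r)).scomp x
          (Real.hasDerivAt_rpow_const (p := r) (Or.inl hx.ne'))
        refine this.congr_deriv ?_
        simp only [smul_smul]
      · have e := (H₂ _ _ (H₁ C g' h3)).const_smul r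
        rw [show (m - 1) * r + (r - 1) = m * r - 1 by ring] at e
        exact e.mono (by nlinarith)

/-- Exponential decay of `exp (-w y) g y` for symbols `g`. -/
lemma isBigO_exp_mul (h : SymbolBound L m C g) {w : ℂ} (hw : 0 < w.re) :
    (fun y : ℝ => Complex.exp (-w * y) * g y) =O[atTop]
      fun y : ℝ => Real.exp (-(w.re / 2) * y) := by
  have h1 : (fun y : ℝ => Complex.exp (-w * y) * g y) =O[atTop]
      fun y : ℝ => Real.exp (-w.re * y) * y ^ m := by
    refine Asymptotics.IsBigO.of_bound C ?_
    filter_upwards [eventually_gt_atTop 0] with y hy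
    rw [norm_mul, Complex.norm_exp, norm_mul, Real.norm_of_nonneg (Real.exp_pos _).le,
      Real.norm_of_nonneg (Real.rpow_nonneg hy.le _)]
    simp only [Complex.mul_re, Complex.neg_re, Complex.ofReal_re, Complex.ofReal_im, mul_zero,
      sub_zero]
    calc _ ≤ Real.exp (-w.re * y) * (C * y ^ m) := by gcongr; exact h.norm_le hy
      _ = _ := by ring
  refine h1.trans ?_
  have h2 := (isLittleO_rpow_exp_pos_mul_atTop m (half_pos hw)).isBigO
  have h3 := (Asymptotics.isBigO_refl (fun y : ℝ => Real.exp (-w.re * y)) atTop).mul h2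
  refine h3.congr_right fun y => ?_
  rw [← Real.exp_add]
  ring_nf

lemma integrableOn_Ioi_exp_mul (h : SymbolBound L m C g) {w : ℂ} (hw : 0 < w.re) {y₀ : ℝ}
    (hy₀ : 0 < y₀) : IntegrableOn (fun y : ℝ => Complex.exp (-w * y) * g y) (Ioi y₀) := by
  refine (integrableOn_Ici_iff_integrableOn_Ioi (by finiteness)).1 <|
    (ContinuousOn.locallyIntegrableOn ?_ measurableSet_Ici).integrableOn_of_isBigO_atTop
    (h.isBigO_exp_mul hw) ⟨Ioi y₀, Ioi_mem_atTop y₀, exp_neg_integrableOn_Ioi y₀ (half_pos hw)⟩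
  exact (Continuous.continuousOn (by fun_prop)).mul
    (h.continuousOn.mono fun y hy => hy₀.trans_le hy)

lemma norm_integral_Ioi_exp_mul_le (h : SymbolBound L m C g) (hL : m + 1 < L) {w : ℂ}
    (hw : 0 < w.re) {y₀ : ℝ} (hy₀ : 0 < y₀) (hwy : 1 ≤ ‖w‖ * y₀) :
    ‖∫ y in Ioi y₀, Complex.exp (-w * y) * g y‖ ≤
      (L + 1 / (L - (m + 1))) * (C * y₀ ^ (m + 1)) := by
  have hexp : ∀ y : ℝ, 0 < y → ‖Complex.exp (-w * y)‖ ≤ 1 := fun y hy => by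
    rw [Complex.norm_exp, Real.exp_le_one_iff]
    simp only [Complex.mul_re, Complex.neg_re, Complex.ofReal_re, Complex.ofReal_im, mul_zero,
      sub_zero]
    nlinarith
  induction L generalizing m g with
  | zero =>
    have hm : m < -1 := by norm_num at hL; linarith
    calc ‖∫ y in Ioi y₀, Complex.exp (-w * y) * g y‖ ≤ ∫ y in Ioi y₀, C * y ^ m := by
          refine norm_integral_le_of_norm_le
            ((integrableOn_Ioi_rpow_of_lt hm hy₀).const_mul C) ?_
          refine (ae_restrict_mem measurableSet_Ioi).mono fun y hy => ?_
          have hy' : 0 < y := hy₀.trans hy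
          rw [norm_mul]
          have := h.norm_le hy'
          nlinarith [hexp y hy', norm_nonneg (g y)]
      _ = _ := by
          rw [integral_const_mul, integral_Ioi_rpow_of_lt hm hy₀]
          have : m + 1 ≠ 0 := by linarith
          have h' : (0 : ℝ) - (m + 1) ≠ 0 := by linarith
          push_cast
          field_simp
          ring
  | succ L ih =>
    have hlow := h.of_succ
    obtain ⟨h1, g', h2, h3⟩ := h
    have hC := h3.nonneg
    push_cast at hL ⊢
    have hI := ih h3 (by linarith)
    have hw0 : w ≠ 0 := by rintro rfl; simp at hw
    have hd : ∀ y ∈ Ici y₀, HasDerivAt (fun y : ℝ => Complex.exp (-w * y) * g y)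
        (-w * (Complex.exp (-w * y) * g y) + Complex.exp (-w * y) * g' y) y := fun y hy => by
      have e1 : HasDerivAt (fun y : ℝ => -w * (y : ℂ)) (-w) y := by
        simpa using (Complex.ofRealCLM.hasDerivAt (x := y)).const_mul (-w)
      refine (e1.cexp.mul (h2 y (hy₀.trans_le hy))).congr_deriv ?_
      ring
    have i1 := hlow.integrableOn_Ioi_exp_mul hw hy₀
    have i2 := h3.integrableOn_Ioi_exp_mul hw hy₀
    have hlim : Tendsto (fun y : ℝ => Complex.exp (-w * y) * g y) atTop (𝓝 0) := by
      refine (hlow.isBigO_exp_mul hw).trans_tendsto ?_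
      refine Real.tendsto_exp_atBot.comp ?_
      exact tendsto_id.const_mul_atTop_of_neg (by linarith)
    have key := integral_Ioi_of_hasDerivAt_of_tendsto' hd
      ((i1.const_mul (-w)).add i2) hlim
    rw [integral_add (i1.const_mul (-w)) i2, integral_const_mul] at key
    have hJ : w * ∫ y in Ioi y₀, Complex.exp (-w * y) * g y =
        Complex.exp (-w * y₀) * g y₀ + ∫ y in Ioi y₀, Complex.exp (-w * y) * g' y := by
      linear_combination -key
    have hn := congrArg norm hJ
    rw [norm_mul] at hn
    have hg := h1 y₀ hy₀
    have hb : ‖w‖ * ‖∫ y in Ioi y₀, Complex.exp (-w * y) * g y‖ ≤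
        C * y₀ ^ m + (L + 1 / (L - (m - 1 + 1))) * (C * y₀ ^ (m - 1 + 1)) := by
      rw [hn]
      refine (norm_add_le _ _).trans (add_le_add ?_ hI)
      rw [norm_mul]
      nlinarith [hexp y₀ hy₀, norm_nonneg (g y₀)]
    rw [sub_add_cancel] at hb
    rw [show (L : ℝ) + 1 - (m + 1) = L - m by ring, Real.rpow_add_one hy₀.ne']
    set J := ‖∫ y in Ioi y₀, Complex.exp (-w * y) * g y‖
    calc J ≤ (‖w‖ * y₀) * J := le_mul_of_one_le_left (norm_nonneg _) hwy
      _ = y₀ * (‖w‖ * J) := by ring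
      _ ≤ y₀ * (C * y₀ ^ m + (L + 1 / (L - m)) * (C * y₀ ^ m)) := by gcongr
      _ = _ := by ring

lemma integrableOn_exp_mul (h : SymbolBound L m C g) (hm : -1 < m) {w : ℂ} (hw : 0 < w.re) :
    IntegrableOn (fun y : ℝ => Complex.exp (-w * y) * g y) (Ioi 0) := by
  rw [← Ioc_union_Ioi_eq_Ioi zero_le_one]
  refine IntegrableOn.union ?_ (h.integrableOn_Ioi_exp_mul hw one_pos)
  have hi : IntegrableOn (fun y : ℝ => C * y ^ m) (Ioc 0 1) :=
    ((intervalIntegrable_iff_integrableOn_Ioc_of_le zero_le_one).1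
      (intervalIntegral.intervalIntegrable_rpow' hm)).const_mul C
  refine Integrable.mono' hi ?_ ?_
  · refine ContinuousOn.aestronglyMeasurable ?_ measurableSet_Ioc
    exact (Continuous.continuousOn (by fun_prop)).mul (h.continuousOn.mono Ioc_subset_Ioi_self)
  · refine (ae_restrict_mem measurableSet_Ioc).mono fun y hy => ?_
    rw [norm_mul, Complex.norm_exp]
    have h1 : Real.exp ((-w * (y : ℂ)).re) ≤ 1 := by
      rw [Real.exp_le_one_iff]
      simp only [Complex.mul_re, Complex.neg_re, Complex.ofReal_re, Complex.ofReal_im, mul_zero,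
        sub_zero]
      nlinarith [hy.1]
    nlinarith [h.norm_le hy.1, norm_nonneg (g y)]

/-- The Laplace transform of a symbol of order `m > -1` is `O(‖w‖ ^ (-(m + 1)))`, uniformly in the
right half-plane. -/
lemma norm_integral_exp_mul_le (h : SymbolBound L m C g) (hm : -1 < m) (hL : m + 1 < L) {w : ℂ}
    (hw : 0 < w.re) :
    ‖∫ y in Ioi (0 : ℝ), Complex.exp (-w * y) * g y‖ ≤
      (1 / (m + 1) + (L + 1 / (L - (m + 1)))) * (C * ‖w‖ ^ (-(m + 1))) := by
  have hw0 : w ≠ 0 := by rintro rfl; simp at hw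
  have hwn : 0 < ‖w‖ := norm_pos_iff.2 hw0
  have hy₀ : 0 < ‖w‖⁻¹ := inv_pos.2 hwn
  have hpow : (‖w‖⁻¹) ^ (m + 1) = ‖w‖ ^ (-(m + 1)) := by
    rw [Real.rpow_neg hwn.le, Real.inv_rpow hwn.le]
  have hi := h.integrableOn_exp_mul hm hw
  have htail := h.norm_integral_Ioi_exp_mul_le hL hw hy₀ (by rw [mul_inv_cancel₀ hwn.ne'])
  rw [← Ioc_union_Ioi_eq_Ioi hy₀.le, setIntegral_union (Ioc_disjoint_Ioi le_rfl) measurableSet_Ioi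
    (hi.mono_set Ioc_subset_Ioi_self) (hi.mono_set (Ioi_subset_Ioi hy₀.le))]
  refine (norm_add_le _ _).trans ?_
  rw [hpow] at htail
  rw [add_mul]
  refine add_le_add ?_ htail
  calc ‖∫ y in Ioc 0 ‖w‖⁻¹, Complex.exp (-w * y) * g y‖ ≤ ∫ y in Ioc 0 ‖w‖⁻¹, C * y ^ m := by
        refine norm_integral_le_of_norm_le
          (((intervalIntegrable_iff_integrableOn_Ioc_of_le hy₀.le).1
            (intervalIntegral.intervalIntegrable_rpow' hm)).const_mul C) ?_
        refine (ae_restrict_mem measurableSet_Ioc).mono fun y hy => ?_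
        rw [norm_mul, Complex.norm_exp]
        have h1 : Real.exp ((-w * (y : ℂ)).re) ≤ 1 := by
          rw [Real.exp_le_one_iff]
          simp only [Complex.mul_re, Complex.neg_re, Complex.ofReal_re, Complex.ofReal_im,
            mul_zero, sub_zero]
          nlinarith [hy.1]
        nlinarith [h.norm_le hy.1, norm_nonneg (g y)]
    _ = _ := by
        rw [integral_const_mul, ← intervalIntegral.integral_of_le hy₀.le,
          integral_rpow (Or.inl hm), Real.zero_rpow (by linarith), hpow]
        ring

end SymbolBound

lemma norm_exp_neg_mul_ofReal_le_one {w : ℂ} (hw : 0 ≤ w.re) {y : ℝ} (hy : 0 ≤ y) :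
    ‖Complex.exp (-w * y)‖ ≤ 1 := by
  rw [Complex.norm_exp, Real.exp_le_one_iff]
  simp only [Complex.mul_re, Complex.neg_re, Complex.ofReal_re, Complex.ofReal_im, mul_zero,
    sub_zero]
  nlinarith

lemma symbolBound_rpow (m : ℝ) : SymbolBound 0 m 1 (fun y => ((y ^ m : ℝ) : ℂ)) := by
  refine ⟨?_, fun x hx => ?_⟩
  · exact Complex.continuous_ofReal.comp_continuousOn
      (continuousOn_id.rpow_const fun x hx => Or.inl (ne_of_gt hx))
  · rw [Complex.norm_real, Real.norm_of_nonneg (Real.rpow_nonneg hx.le _), one_mul]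

/-- The Gamma integral `∫ exp (-w y) y ^ (q - 1) dy` for complex `w` in the right half-plane. -/
lemma integral_cexp_neg_mul_rpow {q : ℝ} (hq : 0 < q) {w : ℂ} (hw : 0 < w.re) :
    ∫ y in Ioi (0 : ℝ), Complex.exp (-w * y) * ((y ^ (q - 1) : ℝ) : ℂ) =
      w ^ (-(q : ℂ)) * Complex.Gamma q := by
  have hopen : IsOpen {w : ℂ | 0 < w.re} := isOpen_lt continuous_const Complex.continuous_re
  set Φ : ℂ → ℂ := fun w => ∫ y in Ioi (0 : ℝ), Complex.exp (-w * y) * ((y ^ (q - 1) : ℝ) : ℂ)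
    with hΦ
  have hd : DifferentiableOn ℂ Φ {w : ℂ | 0 < w.re} := by
    intro w₀ hw₀
    have hw₀' : 0 < w₀.re := hw₀
    have hs : {w : ℂ | w₀.re / 2 < w.re} ∈ 𝓝 w₀ :=
      (isOpen_lt continuous_const Complex.continuous_re).mem_nhds (half_lt_self hw₀')
    have hb := integrableOn_rpow_mul_exp_neg_mul_rpow (p := 1) (s := q) (by linarith) one_pos
      (half_pos hw₀')
    refine (hasDerivAt_integral_of_dominated_loc_of_deriv_le (μ := volume.restrict (Ioi (0 : ℝ)))
      (F := fun (w : ℂ) (y : ℝ) => Complex.exp (-w * y) * ((y ^ (q - 1) : ℝ) : ℂ))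
      (F' := fun (w : ℂ) (y : ℝ) => -(y : ℂ) * (Complex.exp (-w * y) * ((y ^ (q - 1) : ℝ) : ℂ)))
      (x₀ := w₀) hs (Eventually.of_forall fun w => ?_)
      ((symbolBound_rpow (q - 1)).integrableOn_exp_mul (by linarith) hw₀') ?_ ?_ hb ?_).2
        |>.differentiableAt.differentiableWithinAt
    · exact (Measurable.aestronglyMeasurable (by fun_prop))
    · exact (Measurable.aestronglyMeasurable (by fun_prop))
    · refine (ae_restrict_mem measurableSet_Ioi).mono fun y hy w hw => ?_
      have hy' : 0 < y := hy
      have hw' : w₀.re / 2 < w.re := hw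
      rw [norm_mul, norm_mul, norm_neg, Complex.norm_real, Complex.norm_real, Complex.norm_exp,
        Real.norm_of_nonneg hy'.le, Real.norm_of_nonneg (Real.rpow_nonneg hy'.le _)]
      simp only [Complex.mul_re, Complex.neg_re, Complex.ofReal_re, Complex.ofReal_im, mul_zero,
        sub_zero, Real.rpow_one]
      calc y * (Real.exp (-w.re * y) * y ^ (q - 1))
          = y ^ (q - 1) * y * Real.exp (-w.re * y) := by ring
        _ = y ^ q * Real.exp (-w.re * y) := by
            rw [← Real.rpow_add_one hy'.ne', sub_add_cancel]
        _ ≤ _ := by gcongr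
    · refine Eventually.of_forall fun y w _ => ?_
      have e1 : HasDerivAt (fun w : ℂ => -w * (y : ℂ)) (-(y : ℂ)) w := by
        simpa using (hasDerivAt_id w).neg.mul_const (y : ℂ)
      refine (e1.cexp.mul_const _).congr_deriv ?_
      ring
  have hd2 : DifferentiableOn ℂ (fun w : ℂ => w ^ (-(q : ℂ)) * Complex.Gamma q)
      {w : ℂ | 0 < w.re} := fun w hw =>
    ((differentiableAt_id.cpow_const (Or.inl hw)).mul_const _).differentiableWithinAt
  have hconn : IsPreconnected {w : ℂ | 0 < w.re} := (convex_halfSpace_re_gt 0).isPreconnected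
  refine (hd.analyticOnNhd hopen).eqOn_of_preconnected_of_frequently_eq
    (hd2.analyticOnNhd hopen) hconn (z₀ := 1) (by simp) ?_ hw
  have hreal : ∀ r : ℝ, 0 < r → Φ (r : ℂ) = (r : ℂ) ^ (-(q : ℂ)) * Complex.Gamma q := by
    intro r hr
    have := Complex.integral_cpow_mul_exp_neg_mul_Ioi (a := q) (by simpa using hq) hr
    rw [one_div, Complex.inv_cpow _ _ (by
      rw [Complex.arg_ofReal_of_nonneg hr.le]; exact Real.pi_pos.ne), ← Complex.cpow_neg] at this
    rw [← this, hΦ]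
    refine setIntegral_congr_fun measurableSet_Ioi fun y hy => ?_
    have hy' : (0 : ℝ) ≤ y := le_of_lt hy
    rw [Complex.ofReal_cpow hy']
    push_cast
    rw [mul_comm, neg_mul]
  have htend : Tendsto (fun n : ℕ => ((1 + 1 / ((n : ℝ) + 1) : ℝ) : ℂ)) atTop (𝓝[≠] 1) := by
    refine tendsto_nhdsWithin_iff.2 ⟨?_, Eventually.of_forall fun n => ?_⟩
    · have := (tendsto_one_div_add_atTop_nhds_zero_nat (𝕜 := ℝ)).const_add 1
      rw [add_zero] at this
      have := (Complex.continuous_ofReal.tendsto 1).comp this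
      rwa [Complex.ofReal_one] at this
    · have : (0 : ℝ) < 1 / ((n : ℝ) + 1) := by positivity
      simp only [mem_compl_iff, mem_singleton_iff]
      norm_cast
      intro h
      have h2 : (1 + 1 / ((n : ℝ) + 1)) = 1 := by exact_mod_cast h
      linarith
  exact htend.frequently (Frequently.of_forall fun n => hreal _ (by positivity))

section TaylorSymbol

variable {F : ℕ → ℝ → ℂ}

lemma hasDerivAt_sub_taylor (hF : ∀ k x, HasDerivAt (F k) (F (k + 1) x) x) (K : ℕ) (x : ℝ) :
    HasDerivAt (fun x : ℝ => F 0 x - ∑ k ∈ Finset.range (K + 1), (x ^ k / k.factorial : ℝ) • F k 0)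
      (F 1 x - ∑ k ∈ Finset.range K, (x ^ k / k.factorial : ℝ) • F (k + 1) 0) x := by
  simp only [Finset.sum_range_succ' _ K]
  refine (hF 0 x).sub ?_
  simp only [pow_zero]
  refine (HasDerivAt.fun_sum fun k _ => ?_).add_const _
  refine HasDerivAt.smul_const ?_ _
  refine ((hasDerivAt_pow (k + 1) x).div_const _).congr_deriv ?_
  rw [Nat.factorial_succ]
  push_cast
  field_simp

lemma norm_sub_taylor_le (hF : ∀ k x, HasDerivAt (F k) (F (k + 1) x) x) (K : ℕ) {B : ℝ}
    (hB : ∀ x, ‖F K x‖ ≤ B) {x : ℝ} (hx : 0 ≤ x) :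
    ‖F 0 x - ∑ k ∈ Finset.range K, (x ^ k / k.factorial : ℝ) • F k 0‖ ≤ B * x ^ K := by
  induction K generalizing F x with
  | zero => simpa using hB x
  | succ K ih =>
    have hB0 : 0 ≤ B := (norm_nonneg _).trans (hB 0)
    have := Convex.norm_image_sub_le_of_norm_hasDerivWithin_le (C := B * x ^ K) (s := Icc 0 x)
      (fun y _ => (hasDerivAt_sub_taylor hF K y).hasDerivWithinAt)
      (fun y hy => (ih (F := fun k => F (k + 1)) (fun k x => hF (k + 1) x) hB hy.1).trans
        (by have := hy.1; have := hy.2; gcongr))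
      (convex_Icc 0 x) (left_mem_Icc.2 hx) (right_mem_Icc.2 hx)
    simp only [Finset.sum_range_succ' _ K] at this ⊢
    simpa [Real.norm_of_nonneg hx, pow_succ, mul_assoc] using this

lemma norm_le_rpow_of_bounded {f : ℝ → ℂ} {R B : ℝ} (hR : 1 ≤ R) (hsupp : ∀ x, R < x → f x = 0)
    (hB : ∀ x, ‖f x‖ ≤ B) (L : ℕ) {m : ℝ} (hm : m ≤ 0) {x : ℝ} (hx : 0 < x) :
    ‖f x‖ ≤ R ^ (L - m) * B * x ^ m := by
  have hB0 : 0 ≤ B := (norm_nonneg _).trans (hB 0)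
  have hR0 : 0 < R := by linarith
  rcases lt_or_ge R x with h | h
  · rw [hsupp x h, norm_zero]
    positivity
  · have h1 : 1 ≤ R ^ (-m) * x ^ m := by
      rw [Real.rpow_neg hR0.le, ← div_eq_inv_mul, one_le_div (by positivity)]
      exact Real.rpow_le_rpow_of_nonpos hx h hm
    have h2 : R ^ (-m) ≤ R ^ ((L : ℝ) - m) :=
      Real.rpow_le_rpow_of_exponent_le hR (by linarith [(Nat.cast_nonneg L : (0 : ℝ) ≤ L)])
    have h3 : 1 ≤ R ^ ((L : ℝ) - m) * x ^ m := h1.trans (by gcongr)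
    calc ‖f x‖ ≤ B := hB x
      _ ≤ B * (R ^ ((L : ℝ) - m) * x ^ m) := le_mul_of_one_le_right hB0 h3
      _ = _ := by ring

lemma symbolBound_of_bounded (hF : ∀ k x, HasDerivAt (F k) (F (k + 1) x) x) {R B : ℝ} (hR : 1 ≤ R)
    (hsupp : ∀ k x, R < x → F k x = 0) (L : ℕ) {m : ℝ} (hm : m ≤ 0)
    (hB : ∀ k ≤ L, ∀ x, ‖F k x‖ ≤ B) : SymbolBound L m (R ^ (L - m) * B) (F 0) := by
  have hpt : ∀ (L : ℕ) {m : ℝ} {f : ℝ → ℂ}, m ≤ 0 → (∀ x, R < x → f x = 0) → (∀ x, ‖f x‖ ≤ B) →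
      ∀ x, 0 < x → ‖f x‖ ≤ R ^ (L - m) * B * x ^ m :=
    fun L _ _ hm h1 h2 _ hx => norm_le_rpow_of_bounded hR h1 h2 L hm hx
  induction L generalizing F m with
  | zero =>
    exact ⟨fun x _ => (hF 0 x).continuousAt.continuousWithinAt, hpt 0 hm (hsupp 0) (hB 0 le_rfl)⟩
  | succ L ih =>
    refine ⟨hpt (L + 1) hm (hsupp 0) (hB 0 (Nat.zero_le _)), F 1, fun x _ => hF 0 x, ?_⟩
    have := ih (F := fun k => F (k + 1)) (fun k x => hF (k + 1) x) (fun k => hsupp (k + 1))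
      (m := m - 1) (by linarith) (fun k hk => hB (k + 1) (by omega))
    rwa [show (L : ℝ) - (m - 1) = ((L + 1 : ℕ) : ℝ) - m by push_cast; ring] at this

/-- The Taylor remainder at the origin of a smooth function supported in `(-∞, R]` is a symbol. -/
lemma symbolBound_sub_taylor (hF : ∀ k x, HasDerivAt (F k) (F (k + 1) x) x) {R B : ℝ} (hR : 1 ≤ R)
    (hsupp : ∀ k x, R < x → F k x = 0) (L K : ℕ) (hB : ∀ k ≤ K + L, ∀ x, ‖F k x‖ ≤ B) :
    SymbolBound L K (R ^ L * B)
      (fun x => F 0 x - ∑ k ∈ Finset.range K, (x ^ k / k.factorial : ℝ) • F k 0) := by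
  induction L generalizing F K with
  | zero =>
    refine ⟨?_, fun x hx => ?_⟩
    · refine Continuous.continuousOn ?_
      have : Continuous (F 0) := continuous_iff_continuousAt.2 fun x => (hF 0 x).continuousAt
      fun_prop
    · simpa using norm_sub_taylor_le hF K (hB K (by omega)) hx.le
  | succ L ih =>
    cases K with
    | zero =>
      have := symbolBound_of_bounded hF hR hsupp (L + 1) le_rfl fun k hk => hB k (by omega)
      rw [sub_zero, Real.rpow_natCast] at this
      simpa using this
    | succ K =>
      have hB0 : 0 ≤ B := (norm_nonneg _).trans (hB 0 (Nat.zero_le _) 0)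
      refine ⟨fun x hx => ?_, _, fun x _ => hasDerivAt_sub_taylor hF K x, ?_⟩
      · refine (norm_sub_taylor_le hF (K + 1) (hB (K + 1) (by omega)) hx.le).trans ?_
        rw [Real.rpow_natCast]
        gcongr
        exact le_mul_of_one_le_left hB0 (one_le_pow₀ hR)
      · have := ih (F := fun k => F (k + 1)) (fun k x => hF (k + 1) x) (fun k => hsupp (k + 1))
          K (fun k hk => hB (k + 1) (by omega))
        rw [Nat.cast_succ, add_sub_cancel_right]
        refine this.mono ?_
        gcongr
        · exact Nat.le_succ L

end TaylorSymbol

lemma integral_exp_mul_comp_rpow {p : ℝ} (hp : 0 < p) (w : ℂ) (g : ℝ → ℂ) :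
    ∫ x in Ioi (0 : ℝ), Complex.exp (-w * (x ^ p : ℝ)) * g x =
      ∫ y in Ioi (0 : ℝ), Complex.exp (-w * y) * (p⁻¹ • (y ^ (p⁻¹ - 1) • g (y ^ p⁻¹))) := by
  rw [← integral_comp_rpow_Ioi _ (inv_ne_zero hp.ne')]
  refine setIntegral_congr_fun measurableSet_Ioi fun y hy => ?_
  have hy' : (0 : ℝ) < y := hy
  simp only [abs_of_pos (inv_pos.2 hp), Real.rpow_inv_rpow hy'.le hp.ne', Complex.real_smul]
  push_cast
  ring

lemma integral_exp_mul_pow {p : ℝ} (hp : 0 < p) {w : ℂ} (hw : 0 < w.re) (k : ℕ) :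
    ∫ x in Ioi (0 : ℝ), Complex.exp (-w * (x ^ p : ℝ)) * ((x ^ k : ℝ) : ℂ) =
      (p : ℂ)⁻¹ * (w ^ (-((((k : ℝ) + 1) / p : ℝ) : ℂ)) *
        Complex.Gamma ((((k : ℝ) + 1) / p : ℝ) : ℂ)) := by
  rw [integral_exp_mul_comp_rpow hp, ← integral_cexp_neg_mul_rpow (by positivity) hw,
    ← integral_const_mul]
  refine setIntegral_congr_fun measurableSet_Ioi fun y hy => ?_
  have hy' : (0 : ℝ) < y := hy
  have : y ^ (((k : ℝ) + 1) / p - 1) = y ^ (p⁻¹ - 1) * (y ^ p⁻¹) ^ k := by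
    rw [← Real.rpow_mul_natCast hy'.le, ← Real.rpow_add hy']
    congr 1
    field_simp
    ring
  simp only [this, Complex.real_smul]
  push_cast
  ring

lemma integrableOn_exp_mul_pow {p : ℝ} (hp : 0 < p) {w : ℂ} (hw : 0 < w.re) (k : ℕ) :
    IntegrableOn (fun x : ℝ => Complex.exp (-w * (x ^ p : ℝ)) * ((x ^ k : ℝ) : ℂ)) (Ioi 0) := by
  have hb := integrableOn_rpow_mul_exp_neg_mul_rpow (p := p) (s := k)
    (by linarith [(Nat.cast_nonneg k : (0 : ℝ) ≤ k)]) hp hw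
  refine Integrable.mono' hb (Measurable.aestronglyMeasurable (by fun_prop)) ?_
  refine (ae_restrict_mem measurableSet_Ioi).mono fun x hx => ?_
  have hx' : (0 : ℝ) < x := hx
  rw [norm_mul, Complex.norm_exp, Complex.norm_real, Real.norm_of_nonneg (by positivity),
    Real.rpow_natCast, mul_comm]
  simp only [Complex.mul_re, Complex.neg_re, Complex.ofReal_re, Complex.ofReal_im, mul_zero,
    sub_zero, le_refl]

lemma integrableOn_Ioi_of_eq_zero {f : ℝ → ℂ} (hf : Continuous f) {R : ℝ} (hR : 0 ≤ R)
    (hsupp : ∀ x, R < x → f x = 0) : IntegrableOn f (Ioi 0) := by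
  rw [← Ioc_union_Ioi_eq_Ioi hR]
  refine IntegrableOn.union (hf.integrableOn_Ioc) ?_
  exact (integrableOn_zero (μ := volume) (s := Ioi R)).congr_fun
    (fun x hx => (hsupp x hx).symm) measurableSet_Ioi

/-- Laplace-type expansion, uniform in the amplitude and in the right half-plane. -/
lemma exists_laplace_expansion {p : ℝ} (hp : 0 < p) (K : ℕ) {R : ℝ} (hR : 1 ≤ R) :
    ∃ (A : ℝ) (D : ℕ), 0 ≤ A ∧ ∀ (F : ℕ → ℝ → ℂ) (B : ℝ),
      (∀ k x, HasDerivAt (F k) (F (k + 1) x) x) → (∀ k x, R < x → F k x = 0) →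
      (∀ k ≤ D, ∀ x, ‖F k x‖ ≤ B) → ∀ w : ℂ, 0 < w.re →
      ‖(∫ x in Ioi (0 : ℝ), Complex.exp (-w * (x ^ p : ℝ)) * F 0 x) -
        ∑ k ∈ Finset.range K, (p : ℂ)⁻¹ * (w ^ (-((((k : ℝ) + 1) / p : ℝ) : ℂ)) *
          Complex.Gamma ((((k : ℝ) + 1) / p : ℝ) : ℂ)) * (F k 0 / k.factorial)‖ ≤
        A * B * ‖w‖ ^ (-(((K : ℝ) + 1) / p)) := by
  obtain ⟨L, hL⟩ := exists_nat_gt (((K : ℝ) + 1) / p)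
  obtain ⟨A₁, hA₁, H₁⟩ := SymbolBound.exists_comp_rpow L K p⁻¹
  obtain ⟨A₂, hA₂, H₂⟩ := SymbolBound.exists_rpow_smul L (K * p⁻¹) (p⁻¹ - 1)
  set q : ℝ := ((K : ℝ) + 1) / p with hq
  have hq0 : 0 < q := by positivity
  have hqL : 0 < (L : ℝ) - q := by linarith
  refine ⟨(1 / q + (L + 1 / (L - q))) * (|p⁻¹| * (A₂ * (A₁ * R ^ L))), K + L, by positivity,
    fun F B hF hsupp hB w hw => ?_⟩
  have hcont : Continuous (F 0) := continuous_iff_continuousAt.2 fun x => (hF 0 x).continuousAt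
  set g : ℝ → ℂ := fun x => F 0 x - ∑ k ∈ Finset.range K, (x ^ k / k.factorial : ℝ) • F k 0
    with hg
  have hS := (H₂ _ _ (H₁ _ g (symbolBound_sub_taylor hF hR hsupp L K hB))).const_smul p⁻¹
  have hm : (K : ℝ) * p⁻¹ + (p⁻¹ - 1) = q - 1 := by rw [hq]; field_simp; ring
  rw [hm] at hS
  have hbound := hS.norm_integral_exp_mul_le (by linarith) (by linarith) hw
  rw [← integral_exp_mul_comp_rpow hp w g, sub_add_cancel] at hbound
  have hF0 : IntegrableOn (fun x : ℝ => Complex.exp (-w * (x ^ p : ℝ)) * F 0 x) (Ioi 0) := by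
    refine (integrableOn_Ioi_of_eq_zero hcont (by linarith) (hsupp 0)).bdd_mul (c := 1)
      (Measurable.aestronglyMeasurable (by fun_prop)) ?_
    refine (ae_restrict_mem measurableSet_Ioi).mono fun x hx => ?_
    exact norm_exp_neg_mul_ofReal_le_one hw.le (Real.rpow_nonneg (le_of_lt hx) _)
  have hsplit : ∫ x in Ioi (0 : ℝ), Complex.exp (-w * (x ^ p : ℝ)) * g x =
      (∫ x in Ioi (0 : ℝ), Complex.exp (-w * (x ^ p : ℝ)) * F 0 x) -
        ∑ k ∈ Finset.range K, (p : ℂ)⁻¹ * (w ^ (-((((k : ℝ) + 1) / p : ℝ) : ℂ)) *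
          Complex.Gamma ((((k : ℝ) + 1) / p : ℝ) : ℂ)) * (F k 0 / k.factorial) := by
    have hi : ∀ k ∈ Finset.range K, IntegrableOn (fun x : ℝ =>
        Complex.exp (-w * (x ^ p : ℝ)) * ((x ^ k : ℝ) : ℂ) * (F k 0 / k.factorial)) (Ioi 0) :=
      fun k _ => (integrableOn_exp_mul_pow hp hw k).mul_const _
    simp_rw [← integral_exp_mul_pow hp hw, ← integral_mul_const]
    rw [← integral_finsetSum _ hi, ← integral_sub hF0 (integrable_finsetSum _ hi)]
    congr 1
    ext x
    rw [hg, mul_sub, Finset.mul_sum]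
    congr 1
    refine Finset.sum_congr rfl fun k _ => ?_
    rw [Complex.real_smul]
    push_cast
    ring
  rw [← hsplit]
  refine hbound.trans_eq ?_
  ring

/-- The coefficient `p⁻¹ exp (± i π (k + 1) / (2 p)) Γ ((k + 1) / p)`. -/
noncomputable def oscCoeff (p s : ℝ) (k : ℕ) : ℂ :=
  (p : ℂ)⁻¹ * Complex.exp (s * Complex.I * ((Real.pi * ((k : ℝ) + 1) / (2 * p) : ℝ) : ℂ)) *
    Complex.Gamma ((((k : ℝ) + 1) / p : ℝ) : ℂ)

lemma neg_I_mul_cpow {s lam : ℝ} (hs : s = 1 ∨ s = -1) (hlam : 0 < lam) (q : ℝ) :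
    (-(Complex.I * lam * s)) ^ (-(q : ℂ)) =
      ((lam ^ (-q) : ℝ) : ℂ) * Complex.exp (s * Complex.I * (Real.pi * q / 2 : ℝ)) := by
  have hlog : Complex.log (-(Complex.I * lam * s)) =
      Real.log lam - s * (Real.pi / 2 : ℝ) * Complex.I := by
    have hexp : -(Complex.I * lam * s) =
        Complex.exp (Real.log lam - s * (Real.pi / 2 : ℝ) * Complex.I) := by
      rw [Complex.exp_sub, ← Complex.ofReal_exp, Real.exp_log hlam]
      rcases hs with rfl | rfl
      · simp [Complex.exp_pi_div_two_mul_I]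
        ring
      · simp [Complex.exp_neg, Complex.exp_pi_div_two_mul_I]
        rw [← mul_right_inj' Complex.I_ne_zero]
        field_simp
        simp
    rw [hexp, Complex.log_exp]
    · rcases hs with rfl | rfl <;> simp <;> linarith [Real.pi_pos]
    · rcases hs with rfl | rfl <;> simp <;> linarith [Real.pi_pos]
  have hne : -(Complex.I * lam * s) ≠ 0 := by
    rcases hs with rfl | rfl <;> simp [hlam.ne']
  rw [Complex.cpow_def_of_ne_zero hne, hlog, Real.rpow_def_of_pos hlam, Complex.ofReal_exp,
    ← Complex.exp_add]
  congr 1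
  push_cast
  ring

/-- One-dimensional expansion with an error uniform in the amplitude. -/
theorem exists_oscillatory_expansion {p s : ℝ} (hp : 0 < p) (hs : s = 1 ∨ s = -1) (K : ℕ) {R : ℝ}
    (hR : 1 ≤ R) :
    ∃ (A : ℝ) (D : ℕ), 0 ≤ A ∧ ∀ (F : ℕ → ℝ → ℂ) (B : ℝ),
      (∀ k x, HasDerivAt (F k) (F (k + 1) x) x) → (∀ k x, R < x → F k x = 0) →
      (∀ k ≤ D, ∀ x, ‖F k x‖ ≤ B) → ∀ lam : ℝ, 0 < lam →
      ‖(∫ x in Ioi (0 : ℝ), Complex.exp (Complex.I * lam * ((s * x ^ p : ℝ) : ℂ)) * F 0 x) -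
        ∑ k ∈ Finset.range K, oscCoeff p s k * (F k 0 / k.factorial) *
          ((lam ^ (-(((k : ℝ) + 1) / p)) : ℝ) : ℂ)‖ ≤ A * B * lam ^ (-(((K : ℝ) + 1) / p)) := by
  obtain ⟨A, D, hA, H⟩ := exists_laplace_expansion hp K hR
  refine ⟨A, D, hA, fun F B hF hsupp hB lam hlam => ?_⟩
  have hB0 : 0 ≤ B := (norm_nonneg _).trans (hB 0 (Nat.zero_le _) 0)
  have hcont : Continuous (F 0) := continuous_iff_continuousAt.2 fun x => (hF 0 x).continuousAt
  set w₀ : ℂ := -(Complex.I * lam * s) with hw₀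
  have hw₀re : w₀.re = 0 := by simp [hw₀]
  have hw₀slit : w₀ ∈ Complex.slitPlane := by
    rw [Complex.mem_slitPlane_iff]
    right
    rcases hs with rfl | rfl <;> simp [hw₀, hlam.ne']
  set W : ℝ → ℂ := fun ε => w₀ + ε with hW
  have hWre : ∀ ε, (W ε).re = ε := fun ε => by simp [hW, hw₀re]
  have hWtend : Tendsto W (𝓝[>] 0) (𝓝 w₀) := by
    have : Continuous W := by fun_prop
    have h0 := this.tendsto 0
    rw [show W 0 = w₀ by simp [hW]] at h0
    exact h0.mono_left nhdsWithin_le_nhds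
  have hosc : Tendsto (fun ε => ∫ x in Ioi (0 : ℝ), Complex.exp (-W ε * (x ^ p : ℝ)) * F 0 x)
      (𝓝[>] 0) (𝓝 (∫ x in Ioi (0 : ℝ), Complex.exp (-w₀ * (x ^ p : ℝ)) * F 0 x)) := by
    refine tendsto_integral_filter_of_dominated_convergence (fun x => ‖F 0 x‖)
      (Eventually.of_forall fun ε => ?_) ?_
      (integrableOn_Ioi_of_eq_zero hcont (by linarith) (hsupp 0)).norm ?_
    · exact AEStronglyMeasurable.mul (Measurable.aestronglyMeasurable (by fun_prop))
        hcont.aestronglyMeasurable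
    · filter_upwards [self_mem_nhdsWithin] with ε hε
      refine (ae_restrict_mem measurableSet_Ioi).mono fun x hx => ?_
      rw [norm_mul]
      refine mul_le_of_le_one_left (norm_nonneg _) ?_
      refine norm_exp_neg_mul_ofReal_le_one ?_ (Real.rpow_nonneg (le_of_lt hx) _)
      rw [hWre]
      exact le_of_lt hε
    · refine Eventually.of_forall fun x => ?_
      exact (((Complex.continuous_exp.tendsto _).comp
        (hWtend.neg.mul_const _))).mul_const _
  have hsum : Tendsto (fun ε => ∑ k ∈ Finset.range K, (p : ℂ)⁻¹ *
        (W ε ^ (-((((k : ℝ) + 1) / p : ℝ) : ℂ)) * Complex.Gamma ((((k : ℝ) + 1) / p : ℝ) : ℂ)) *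
          (F k 0 / k.factorial)) (𝓝[>] 0)
      (𝓝 (∑ k ∈ Finset.range K, (p : ℂ)⁻¹ *
        (w₀ ^ (-((((k : ℝ) + 1) / p : ℝ) : ℂ)) * Complex.Gamma ((((k : ℝ) + 1) / p : ℝ) : ℂ)) *
          (F k 0 / k.factorial))) := by
    refine tendsto_finsetSum _ fun k _ => ?_
    have hc : Tendsto (fun ε => W ε ^ (-((((k : ℝ) + 1) / p : ℝ) : ℂ))) (𝓝[>] 0)
        (𝓝 (w₀ ^ (-((((k : ℝ) + 1) / p : ℝ) : ℂ)))) :=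
      hWtend.cpow tendsto_const_nhds hw₀slit
    exact ((hc.mul_const _).const_mul _).mul_const _
  have hlim := le_of_tendsto (hosc.sub hsum).norm (b := A * B * lam ^ (-(((K : ℝ) + 1) / p))) (by
    filter_upwards [self_mem_nhdsWithin] with ε hε
    have hε' : 0 < ε := hε
    refine (H F B hF hsupp hB (W ε) (by rwa [hWre])).trans ?_
    refine mul_le_mul_of_nonneg_left ?_ (mul_nonneg hA hB0)
    refine Real.rpow_le_rpow_of_nonpos hlam ?_ (by
      have : 0 < ((K : ℝ) + 1) / p := by positivity
      linarith)
    have him : |(W ε).im| = lam := by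
      rcases hs with rfl | rfl <;> simp [hW, hw₀, abs_of_pos hlam]
    exact him ▸ Complex.abs_im_le_norm _)
  have hosc_eq :
      ∫ x in Ioi (0 : ℝ), Complex.exp (Complex.I * lam * ((s * x ^ p : ℝ) : ℂ)) * F 0 x =
      ∫ x in Ioi (0 : ℝ), Complex.exp (-w₀ * (x ^ p : ℝ)) * F 0 x := by
    refine setIntegral_congr_fun measurableSet_Ioi fun x _ => ?_
    simp only [hw₀]
    congr 2
    push_cast
    ring
  have hsum_eq : ∑ k ∈ Finset.range K, oscCoeff p s k * (F k 0 / k.factorial) *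
        ((lam ^ (-(((k : ℝ) + 1) / p)) : ℝ) : ℂ) =
      ∑ k ∈ Finset.range K, (p : ℂ)⁻¹ * (w₀ ^ (-((((k : ℝ) + 1) / p : ℝ) : ℂ)) *
        Complex.Gamma ((((k : ℝ) + 1) / p : ℝ) : ℂ)) * (F k 0 / k.factorial) := by
    refine Finset.sum_congr rfl fun k _ => ?_
    rw [hw₀, neg_I_mul_cpow hs hlam, oscCoeff,
      show Real.pi * (((k : ℝ) + 1) / p) / 2 = Real.pi * ((k : ℝ) + 1) / (2 * p) by
        field_simp]
    ring
  rw [hosc_eq, hsum_eq]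
  exact hlim

lemma hasDerivAt_comp_update {n : ℕ} {g : (Fin n → ℝ) → ℂ} (hg : ContDiff ℝ (⊤ : ℕ∞) g) (j : Fin n)
    (x : Fin n → ℝ) (t : ℝ) :
    HasDerivAt (fun t : ℝ => g (Function.update x j t)) (pderiv j g (Function.update x j t)) t := by
  have h1 : DifferentiableAt ℝ (fun t : ℝ => g (Function.update x j t)) t :=
    ((hg.differentiable (by simp)) _).comp t (hasDerivAt_update x j t).differentiableAt
  have h2 := h1.hasDerivAt
  simpa [pderiv] using h2

lemma pderiv_eq_fderiv {n : ℕ} {g : (Fin n → ℝ) → ℂ} (hg : ContDiff ℝ (⊤ : ℕ∞) g) (j : Fin n)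
    (x : Fin n → ℝ) : pderiv j g x = fderiv ℝ g x (Pi.single j 1) := by
  have h := ((hg.differentiable (by simp)) (Function.update x j (x j))).hasFDerivAt.comp_hasDerivAt
    (x j) (hasDerivAt_update x j (x j))
  rw [Function.update_eq_self] at h
  exact h.deriv

lemma contDiff_pderiv {n : ℕ} {g : (Fin n → ℝ) → ℂ} (hg : ContDiff ℝ (⊤ : ℕ∞) g) (j : Fin n) :
    ContDiff ℝ (⊤ : ℕ∞) (pderiv j g) := by
  rw [show pderiv j g = fun x => fderiv ℝ g x (Pi.single j 1) from funext (pderiv_eq_fderiv hg j)]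
  exact (hg.fderiv_right (m := (⊤ : ℕ∞)) (by simp)).clm_apply contDiff_const

lemma contDiff_iterate_pderiv {n : ℕ} {g : (Fin n → ℝ) → ℂ} (hg : ContDiff ℝ (⊤ : ℕ∞) g)
    (j : Fin n) (k : ℕ) : ContDiff ℝ (⊤ : ℕ∞) ((pderiv j)^[k] g) := by
  induction k with
  | zero => exact hg
  | succ k ih =>
    rw [Function.iterate_succ_apply']
    exact contDiff_pderiv ih j

lemma pderiv_eq_zero {n : ℕ} {g : (Fin n → ℝ) → ℂ} {R : ℝ} (hR : ∀ x, R < ‖x‖ → g x = 0)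
    (j : Fin n) (x : Fin n → ℝ) (hx : R < ‖x‖) : pderiv j g x = 0 := by
  have hc : Continuous fun t : ℝ => ‖Function.update x j t‖ := by fun_prop
  have h : (fun t : ℝ => g (Function.update x j t)) =ᶠ[𝓝 (x j)] fun _ => 0 := by
    filter_upwards [hc.continuousAt.eventually_const_lt (u := R) (by simpa using hx)] with t ht
    exact hR _ ht
  rw [pderiv, h.deriv_eq, deriv_const]

lemma iterate_pderiv_eq_zero {n : ℕ} {g : (Fin n → ℝ) → ℂ} {R : ℝ}
    (hR : ∀ x, R < ‖x‖ → g x = 0) (j : Fin n) (k : ℕ) (x : Fin n → ℝ) (hx : R < ‖x‖) :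
    (pderiv j)^[k] g x = 0 := by
  induction k generalizing x with
  | zero => exact hR x hx
  | succ k ih =>
    rw [Function.iterate_succ_apply']
    exact pderiv_eq_zero ih j x hx

/-- The slice `x ↦ g (x, t)`. -/
def lastSlice {n : ℕ} (g : (Fin (n + 1) → ℝ) → ℂ) (t : ℝ) (x : Fin n → ℝ) : ℂ :=
  g (Fin.snoc (α := fun _ => ℝ) x t)

lemma lastSlice_pderiv {n : ℕ} (g : (Fin (n + 1) → ℝ) → ℂ) (t : ℝ) (j : Fin n) :
    lastSlice (pderiv j.castSucc g) t = pderiv j (lastSlice g t) := by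
  ext x
  simp [lastSlice, pderiv, Fin.snoc_update]

lemma lastSlice_iterate_pderiv {n : ℕ} (g : (Fin (n + 1) → ℝ) → ℂ) (t : ℝ) (j : Fin n) (k : ℕ) :
    lastSlice ((pderiv j.castSucc)^[k] g) t = (pderiv j)^[k] (lastSlice g t) := by
  induction k with
  | zero => rfl
  | succ k ih => rw [Function.iterate_succ_apply', Function.iterate_succ_apply', lastSlice_pderiv, ih]

lemma multiDeriv_snoc_zero {n : ℕ} (α : Fin (n + 1) → ℕ) (g : (Fin (n + 1) → ℝ) → ℂ) :
    multiDeriv α g 0 = multiDeriv (fun j => α j.castSucc)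
      (lastSlice ((pderiv (Fin.last n))^[α (Fin.last n)] g) 0) 0 := by
  have hfold : ∀ (l : List (Fin n)) (G₀ : ((Fin (n + 1) → ℝ) → ℂ) → ((Fin (n + 1) → ℝ) → ℂ)),
      lastSlice ((l.foldr (fun j G => (pderiv j.castSucc)^[α j.castSucc] ∘ G) G₀) g) 0 =
        (l.foldr (fun j G => (pderiv j)^[α j.castSucc] ∘ G) id) (lastSlice (G₀ g) 0) := by
    intro l G₀
    induction l with
    | nil => rfl
    | cons j l ih =>
      simp only [List.foldr_cons, Function.comp_apply]
      rw [lastSlice_iterate_pderiv, ih]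
  have hz : Fin.snoc (α := fun _ => ℝ) (0 : Fin n → ℝ) 0 = (0 : Fin (n + 1) → ℝ) := by
    ext j
    refine Fin.lastCases ?_ (fun j => ?_) j <;> simp
  have h := congrFun (hfold (List.finRange n)
    ((pderiv (Fin.last n))^[α (Fin.last n)] ∘ id)) 0
  rw [lastSlice, hz] at h
  rw [multiDeriv, multiDeriv, List.finRange_succ_last, List.foldr_append, List.foldr_map]
  exact h

lemma norm_le_norm_snoc {n : ℕ} (x : Fin n → ℝ) (t : ℝ) :
    ‖x‖ ≤ ‖Fin.snoc (α := fun _ => ℝ) x t‖ := by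
  refine (pi_norm_le_iff_of_nonneg (norm_nonneg _)).2 fun j => ?_
  simpa using norm_le_pi_norm (Fin.snoc (α := fun _ => ℝ) x t) j.castSucc

lemma abs_le_norm_snoc {n : ℕ} (x : Fin n → ℝ) (t : ℝ) :
    |t| ≤ ‖Fin.snoc (α := fun _ => ℝ) x t‖ := by
  simpa using norm_le_pi_norm (Fin.snoc (α := fun _ => ℝ) x t) (Fin.last n)

lemma contDiff_lastSlice {n : ℕ} {g : (Fin (n + 1) → ℝ) → ℂ} (hg : ContDiff ℝ (⊤ : ℕ∞) g) (t : ℝ) :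
    ContDiff ℝ (⊤ : ℕ∞) (lastSlice g t) := by
  refine hg.comp (contDiff_pi.2 fun j => ?_)
  refine Fin.lastCases ?_ (fun j => ?_) j
  · simpa using contDiff_const
  · simpa using contDiff_apply ℝ ℝ j

lemma hasDerivAt_lastSlice {n : ℕ} {g : (Fin (n + 1) → ℝ) → ℂ} (hg : ContDiff ℝ (⊤ : ℕ∞) g)
    (x : Fin n → ℝ) (t : ℝ) :
    HasDerivAt (fun t => lastSlice g t x) (lastSlice (pderiv (Fin.last n) g) t x) t := by
  have := hasDerivAt_comp_update hg (Fin.last n) (Fin.snoc (α := fun _ => ℝ) x t) t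
  simp only [Fin.update_snoc_last] at this
  exact this

/-- Lebesgue measure on the open positive orthant. -/
noncomputable abbrev orthantMeasure (n : ℕ) : Measure (Fin n → ℝ) :=
  Measure.pi fun _ => volume.restrict (Ioi (0 : ℝ))

lemma orthantMeasure_eq (n : ℕ) :
    orthantMeasure n = volume.restrict {x : Fin n → ℝ | ∀ j, 0 < x j} := by
  rw [orthantMeasure, ← Measure.restrict_pi_pi, ← volume_pi]
  congr 1
  ext x
  simp

lemma integrable_orthantMeasure {n : ℕ} {E : Type*} [NormedAddCommGroup E] {g : (Fin n → ℝ) → E}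
    (hg : Integrable g) : Integrable g (orthantMeasure n) := by
  rw [orthantMeasure_eq]
  exact hg.restrict

/-- The oscillatory factor `exp (i λ ∑ ±_j x_j ^ p_j)`. -/
noncomputable def oscFactor {n : ℕ} (p sgn : Fin n → ℝ) (lam : ℝ) (x : Fin n → ℝ) : ℂ :=
  Complex.exp (Complex.I * lam * ((∑ j, sgn j * x j ^ p j : ℝ) : ℂ))

lemma measurable_oscFactor {n : ℕ} (p sgn : Fin n → ℝ) (lam : ℝ) :
    Measurable (oscFactor p sgn lam) := by
  unfold oscFactor
  fun_prop

lemma norm_oscFactor {n : ℕ} (p sgn : Fin n → ℝ) (lam : ℝ) (x : Fin n → ℝ) :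
    ‖oscFactor p sgn lam x‖ = 1 := by
  rw [oscFactor, mul_assoc, ← Complex.ofReal_mul, Complex.norm_exp_I_mul_ofReal]

/-- The oscillatory integral over the positive orthant. -/
noncomputable def orthantIntegral {n : ℕ} (p sgn : Fin n → ℝ) (lam : ℝ) (a : (Fin n → ℝ) → ℂ) : ℂ :=
  ∫ x, oscFactor p sgn lam x * a x ∂orthantMeasure n

lemma integrable_oscFactor_mul {n : ℕ} (p sgn : Fin n → ℝ) (lam : ℝ) {a : (Fin n → ℝ) → ℂ}
    (ha : Continuous a) {R : ℝ} (hR : ∀ x, R < ‖x‖ → a x = 0) :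
    Integrable (fun x => oscFactor p sgn lam x * a x) (orthantMeasure n) := by
  refine Integrable.bdd_mul (c := 1) (integrable_orthantMeasure ?_)
    (measurable_oscFactor p sgn lam).aestronglyMeasurable
    (Eventually.of_forall fun x => (norm_oscFactor p sgn lam x).le)
  refine ha.integrable_of_hasCompactSupport
    (HasCompactSupport.intro (isCompact_closedBall 0 R) fun x hx => hR x ?_)
  simpa using hx

lemma orthantIntegral_succ {n : ℕ} (p sgn : Fin (n + 1) → ℝ) (lam : ℝ)
    {a : (Fin (n + 1) → ℝ) → ℂ} (ha : Continuous a) {R : ℝ} (hR : ∀ x, R < ‖x‖ → a x = 0) :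
    orthantIntegral p sgn lam a = ∫ t in Ioi (0 : ℝ),
      Complex.exp (Complex.I * lam * ((sgn (Fin.last n) * t ^ p (Fin.last n) : ℝ) : ℂ)) *
        orthantIntegral (fun j => p j.castSucc) (fun j => sgn j.castSucc) lam (lastSlice a t) := by
  have hmp := (measurePreserving_piFinSuccAbove
    (fun _ : Fin (n + 1) => volume.restrict (Ioi (0 : ℝ))) (Fin.last n)).symm
  have hosc := (hmp.integrable_comp_emb (MeasurableEquiv.measurableEmbedding _)).2
    (integrable_oscFactor_mul p sgn lam ha hR)
  rw [orthantIntegral, ← hmp.integral_comp']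
  refine (integral_prod _ hosc).trans (integral_congr_ae (Eventually.of_forall fun t => ?_))
  simp only [orthantIntegral]
  rw [← integral_const_mul]
  refine integral_congr_ae (Eventually.of_forall fun x => ?_)
  change oscFactor p sgn lam (Fin.insertNth (Fin.last n) t x) *
    a (Fin.insertNth (Fin.last n) t x) = _
  simp only [Fin.insertNth_last', oscFactor, lastSlice, Fin.sum_univ_castSucc, Fin.snoc_castSucc,
    Fin.snoc_last]
  rw [← mul_assoc, ← Complex.exp_add]
  congr 2
  push_cast
  ring

lemma exists_integrable_bound_lastSlice {n : ℕ} {a : (Fin (n + 1) → ℝ) → ℂ} (ha : Continuous a)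
    {R : ℝ} (hR : ∀ x, R < ‖x‖ → a x = 0) :
    ∃ b : (Fin n → ℝ) → ℝ, Integrable b (orthantMeasure n) ∧ ∀ t x, ‖lastSlice a t x‖ ≤ b x := by
  have hc : HasCompactSupport a :=
    HasCompactSupport.intro (isCompact_closedBall 0 R) fun x hx => hR x (by simpa using hx)
  obtain ⟨C, hC⟩ := ha.bounded_above_of_compact_support hc
  refine ⟨(Metric.closedBall 0 R).indicator fun _ => C, integrable_orthantMeasure ?_,
    fun t x => ?_⟩
  · rw [integrable_indicator_iff Metric.isClosed_closedBall.measurableSet]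
    exact integrableOn_const (isCompact_closedBall _ _).measure_ne_top
  · by_cases hx : x ∈ Metric.closedBall (0 : Fin n → ℝ) R
    · rw [indicator_of_mem hx]
      exact hC _
    · rw [indicator_of_notMem hx, lastSlice, hR, norm_zero]
      refine lt_of_lt_of_le ?_ (norm_le_norm_snoc x t)
      simpa using hx

lemma hasDerivAt_orthantIntegral_lastSlice {n : ℕ} (p sgn : Fin n → ℝ) (lam : ℝ)
    {a : (Fin (n + 1) → ℝ) → ℂ} (ha : ContDiff ℝ (⊤ : ℕ∞) a)
    {R : ℝ} (hR : ∀ x, R < ‖x‖ → a x = 0) (t : ℝ) :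
    HasDerivAt (fun t => orthantIntegral p sgn lam (lastSlice a t))
      (orthantIntegral p sgn lam (lastSlice (pderiv (Fin.last n) a) t)) t := by
  have hd := contDiff_pderiv ha (Fin.last n)
  obtain ⟨b, hb, hbound⟩ := exists_integrable_bound_lastSlice hd.continuous
    (pderiv_eq_zero hR (Fin.last n))
  have hmeas : ∀ {g : (Fin (n + 1) → ℝ) → ℂ}, ContDiff ℝ (⊤ : ℕ∞) g → ∀ t, AEStronglyMeasurable
      (fun x => oscFactor p sgn lam x * lastSlice g t x) (orthantMeasure n) := fun hg t =>
    (measurable_oscFactor p sgn lam).aestronglyMeasurable.mul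
      (contDiff_lastSlice hg t).continuous.aestronglyMeasurable
  refine (hasDerivAt_integral_of_dominated_loc_of_deriv_le (bound := b) univ_mem
    (Eventually.of_forall (hmeas ha))
    (integrable_oscFactor_mul p sgn lam (contDiff_lastSlice ha t).continuous
      (R := R) fun x hx => hR _ (hx.trans_le (norm_le_norm_snoc x t))) (hmeas hd t)
    (Eventually.of_forall fun x t _ => ?_) hb
    (Eventually.of_forall fun x t _ => (hasDerivAt_lastSlice ha x t).const_mul _)).2
  rw [norm_mul, norm_oscFactor, one_mul]
  exact hbound t x

/-- The term of the expansion indexed by the multi-index `α`. -/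
noncomputable def expansionTerm {n : ℕ} (p sgn : Fin n → ℝ) (lam : ℝ) (a : (Fin n → ℝ) → ℂ)
    (α : Fin n → ℕ) : ℂ :=
  (∏ j, oscCoeff (p j) (sgn j) (α j)) * (multiDeriv α a 0 / (∏ j, ((α j).factorial : ℂ))) *
    ((lam ^ (-∑ j, ((α j : ℝ) + 1) / p j) : ℝ) : ℂ)

lemma expansionTerm_succ {n : ℕ} (p sgn : Fin (n + 1) → ℝ) {lam : ℝ} (hlam : 0 < lam)
    (a : (Fin (n + 1) → ℝ) → ℂ) (α : Fin (n + 1) → ℕ) :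
    expansionTerm p sgn lam a α = oscCoeff (p (Fin.last n)) (sgn (Fin.last n)) (α (Fin.last n)) *
      (expansionTerm (fun j => p j.castSucc) (fun j => sgn j.castSucc) lam
        (lastSlice ((pderiv (Fin.last n))^[α (Fin.last n)] a) 0) (fun j => α j.castSucc) /
          (α (Fin.last n)).factorial) *
      ((lam ^ (-(((α (Fin.last n) : ℝ) + 1) / p (Fin.last n))) : ℝ) : ℂ) := by
  simp only [expansionTerm, multiDeriv_snoc_zero α a, Fin.prod_univ_castSucc,
    Fin.sum_univ_castSucc, neg_add, Real.rpow_add hlam]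
  push_cast
  ring

/-- The expansion over a box of multi-indices. -/
theorem orthantIntegral_sub_box_isBigO {n : ℕ} {p sgn : Fin n → ℝ} (hp : ∀ j, 0 < p j)
    (hsgn : ∀ j, sgn j = 1 ∨ sgn j = -1) {a : (Fin n → ℝ) → ℂ} (ha : ContDiff ℝ (⊤ : ℕ∞) a)
    {R : ℝ} (hR : ∀ x, R < ‖x‖ → a x = 0) {M : ℝ} {K : ℕ}
    (hK : ∀ j, M ≤ ((K : ℝ) + 1) / p j) :
    (fun lam : ℝ => orthantIntegral p sgn lam a -
      ∑ α : Fin n → Fin K, expansionTerm p sgn lam a (fun j => α j)) =O[atTop]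
      fun lam : ℝ => lam ^ (-M) := by
  induction n generalizing R with
  | zero =>
    refine (Asymptotics.isBigO_zero _ _).congr_left fun lam => ?_
    have hdirac : orthantMeasure 0 = Measure.dirac 0 := Measure.pi_of_empty _ 0
    rw [orthantIntegral, hdirac, integral_dirac]
    simp [oscFactor, expansionTerm, multiDeriv]
  | succ n ih =>
    set p' : Fin n → ℝ := fun j => p j.castSucc with hp'
    set sgn' : Fin n → ℝ := fun j => sgn j.castSucc with hsgn'
    set P := p (Fin.last n) with hP
    set s := sgn (Fin.last n) with hs
    set G : ℕ → (Fin (n + 1) → ℝ) → ℂ := fun k => (pderiv (Fin.last n))^[k] a with hG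
    have hGs : ∀ k, ContDiff ℝ (⊤ : ℕ∞) (G k) := contDiff_iterate_pderiv ha _
    have hGR : ∀ k x, R < ‖x‖ → G k x = 0 := iterate_pderiv_eq_zero hR _
    have hGsucc : ∀ k, G (k + 1) = pderiv (Fin.last n) (G k) := fun k =>
      Function.iterate_succ_apply' _ _ _
    set F : ℝ → ℕ → ℝ → ℂ := fun lam k t => orthantIntegral p' sgn' lam (lastSlice (G k) t) with hF
    obtain ⟨A, D, hA, H⟩ := exists_oscillatory_expansion (hp (Fin.last n)) (hsgn (Fin.last n)) K
      (le_max_right R 1)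
    choose b hb hbound using fun k => exists_integrable_bound_lastSlice (hGs k).continuous (hGR k)
    have hb0 : ∀ k, 0 ≤ ∫ x, b k x ∂orthantMeasure n := fun k =>
      integral_nonneg fun x => (norm_nonneg _).trans (hbound k 0 x)
    set B := ∑ k ∈ Finset.range (D + 1), ∫ x, b k x ∂orthantMeasure n with hB
    have hFB : ∀ lam, ∀ k ≤ D, ∀ t, ‖F lam k t‖ ≤ B := fun lam k hk t => by
      have h1 : ‖F lam k t‖ ≤ ∫ x, b k x ∂orthantMeasure n := by
        refine norm_integral_le_of_norm_le (hb k) (Eventually.of_forall fun x => ?_)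
        rw [norm_mul, norm_oscFactor, one_mul]
        exact hbound k t x
      exact h1.trans (Finset.single_le_sum (f := fun k => ∫ x, b k x ∂orthantMeasure n)
        (fun k _ => hb0 k) (Finset.mem_range.2 (by omega)))
    have hFd : ∀ lam k t, HasDerivAt (F lam k) (F lam (k + 1) t) t := fun lam k t => by
      have := hasDerivAt_orthantIntegral_lastSlice p' sgn' lam (hGs k) (hGR k) t
      rwa [← hGsucc] at this
    have hFsupp : ∀ lam k t, max R 1 < t → F lam k t = 0 := fun lam k t ht => by
      have h0 : ∀ x, lastSlice (G k) t x = 0 := fun x => hGR k _ <|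
        ((le_max_left R 1).trans_lt ht).trans_le ((le_abs_self t).trans (abs_le_norm_snoc x t))
      simp [hF, orthantIntegral, h0]
    have hone : (fun lam : ℝ => orthantIntegral p sgn lam a -
        ∑ k ∈ Finset.range K, oscCoeff P s k * (F lam k 0 / k.factorial) *
          ((lam ^ (-(((k : ℝ) + 1) / P)) : ℝ) : ℂ)) =O[atTop] fun lam : ℝ => lam ^ (-M) := by
      refine Asymptotics.IsBigO.of_bound (A * B) ?_
      filter_upwards [eventually_ge_atTop 1] with lam hlam
      have hlam0 : 0 < lam := by linarith
      have hB0 : 0 ≤ B := Finset.sum_nonneg fun k _ => hb0 k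
      rw [orthantIntegral_succ p sgn lam ha.continuous hR,
        Real.norm_of_nonneg (Real.rpow_nonneg hlam0.le _)]
      refine (H (F lam) B (hFd lam) (hFsupp lam) (hFB lam) lam hlam0).trans ?_
      refine mul_le_mul_of_nonneg_left ?_ (mul_nonneg hA hB0)
      exact Real.rpow_le_rpow_of_exponent_le hlam (neg_le_neg (hK _))
    have htwo : (fun lam : ℝ => ∑ k ∈ Finset.range K, oscCoeff P s k * ((F lam k 0 -
          ∑ α : Fin n → Fin K, expansionTerm p' sgn' lam (lastSlice (G k) 0) (fun j => α j)) /
            k.factorial) * ((lam ^ (-(((k : ℝ) + 1) / P)) : ℝ) : ℂ)) =O[atTop]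
        fun lam : ℝ => lam ^ (-M) := by
      refine Asymptotics.IsBigO.fun_sum fun k _ => ?_
      have h1 := ih (fun j => hp j.castSucc) (fun j => hsgn j.castSucc)
        (contDiff_lastSlice (hGs k) 0)
        (fun x hx => hGR k _ (hx.trans_le (norm_le_norm_snoc x 0))) (fun j => hK j.castSucc)
      have h2 : (fun lam : ℝ => ((lam ^ (-(((k : ℝ) + 1) / P)) : ℝ) : ℂ)) =O[atTop]
          fun _ => (1 : ℝ) := by
        refine Asymptotics.IsBigO.of_bound 1 ?_
        filter_upwards [eventually_ge_atTop 1] with lam hlam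
        have hP0 : 0 < P := hp _
        rw [Complex.norm_real, Real.norm_of_nonneg (Real.rpow_nonneg (by linarith) _), norm_one,
          one_mul]
        refine Real.rpow_le_one_of_one_le_of_nonpos hlam ?_
        have : 0 < ((k : ℝ) + 1) / P := by positivity
        linarith
      have h3 := ((h1.const_mul_left (oscCoeff P s k / k.factorial)).mul h2)
      simp only [mul_one] at h3
      refine h3.congr_left fun lam => ?_
      ring
    refine (hone.add htwo).congr' ?_ EventuallyEq.rfl
    filter_upwards [eventually_gt_atTop 0] with lam hlam
    have hsum : ∑ α : Fin (n + 1) → Fin K, expansionTerm p sgn lam a (fun j => α j) =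
        ∑ k ∈ Finset.range K, oscCoeff P s k * ((∑ α : Fin n → Fin K,
          expansionTerm p' sgn' lam (lastSlice (G k) 0) (fun j => α j)) / k.factorial) *
            ((lam ^ (-(((k : ℝ) + 1) / P)) : ℝ) : ℂ) := by
      rw [Finset.sum_range, ← (Fin.snocEquiv fun _ : Fin (n + 1) => Fin K).sum_comp,
        Fintype.sum_prod_type]
      refine Finset.sum_congr rfl fun k _ => ?_
      rw [Finset.sum_div, Finset.mul_sum, Finset.sum_mul]
      refine Finset.sum_congr rfl fun α _ => ?_
      rw [expansionTerm_succ p sgn hlam]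
      simp [Fin.snocEquiv]
      rfl
    rw [hsum, sub_add_eq_add_sub, ← sub_eq_zero]
    simp only [sub_div, mul_sub, sub_mul, Finset.sum_sub_distrib]
    ring

lemma tsum_subtype_eq_sum_box {n K : ℕ} {P : (Fin n → ℕ) → Prop} [DecidablePred P]
    (hP : ∀ α, P α → ∀ j, α j < K) (f : (Fin n → ℕ) → ℂ) :
    ∑' α : {α // P α}, f α =
      ∑ α : Fin n → Fin K, if P (fun j => α j) then f (fun j => α j) else 0 := by
  have hinj : Function.Injective fun (α : Fin n → Fin K) (j : Fin n) => (α j : ℕ) :=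
    fun α β h => funext fun j => Fin.ext (congrFun h j)
  have hsub : Function.support ({α | P α}.indicator f) ⊆
      range fun (α : Fin n → Fin K) (j : Fin n) => (α j : ℕ) := fun α hα =>
    ⟨fun j => ⟨α j, hP α (mem_of_indicator_ne_zero hα) j⟩, rfl⟩
  refine (tsum_subtype {α | P α} f).trans ?_
  rw [← hinj.tsum_eq hsub, tsum_fintype]
  simp only [indicator_apply, mem_ofPred_eq]

lemma expansionTerm_isBigO {n : ℕ} {p sgn : Fin n → ℝ} (a : (Fin n → ℝ) → ℂ) {α : Fin n → ℕ}
    {M : ℝ} (hM : M ≤ ∑ j, ((α j : ℝ) + 1) / p j) :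
    (fun lam : ℝ => expansionTerm p sgn lam a α) =O[atTop] fun lam : ℝ => lam ^ (-M) := by
  refine Asymptotics.IsBigO.const_mul_left (Asymptotics.IsBigO.of_bound 1 ?_) _
  filter_upwards [eventually_ge_atTop 1] with lam hlam
  have hlam0 : 0 ≤ lam := by linarith
  rw [one_mul, Complex.norm_real, Real.norm_of_nonneg (Real.rpow_nonneg hlam0 _),
    Real.norm_of_nonneg (Real.rpow_nonneg hlam0 _)]
  exact Real.rpow_le_rpow_of_exponent_le hlam (neg_le_neg hM)

/-- The expansion up to an arbitrary order `λ ^ (-M)`. -/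
theorem orthantIntegral_sub_tsum_isBigO {n : ℕ} {p sgn : Fin n → ℝ} (hp : ∀ j, 0 < p j)
    (hsgn : ∀ j, sgn j = 1 ∨ sgn j = -1) {a : (Fin n → ℝ) → ℂ} (ha : ContDiff ℝ (⊤ : ℕ∞) a)
    (hsupp : HasCompactSupport a) (M : ℝ) :
    (fun lam : ℝ => orthantIntegral p sgn lam a -
      ∑' α : {α : Fin n → ℕ // ∑ j, ((α j : ℝ) + 1) / p j < M}, expansionTerm p sgn lam a α.1)
      =O[atTop] fun lam : ℝ => lam ^ (-M) := by
  classical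
  obtain ⟨R, hR⟩ := hsupp.isCompact.isBounded.subset_closedBall 0
  have hR' : ∀ x, R < ‖x‖ → a x = 0 := fun x hx =>
    image_eq_zero_of_notMem_tsupport fun h => absurd (hR h) (by simpa using hx)
  obtain ⟨K, hK⟩ : ∃ K : ℕ, ∀ j, M ≤ ((K : ℝ) + 1) / p j := by
    obtain ⟨K, hK⟩ := exists_nat_ge (∑ j, |M| * p j)
    refine ⟨K, fun j => ?_⟩
    rw [le_div_iff₀ (hp j)]
    have h1 := Finset.single_le_sum (f := fun j => |M| * p j)
      (fun j _ => mul_nonneg (abs_nonneg M) (hp j).le) (Finset.mem_univ j)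
    have h2 := mul_le_mul_of_nonneg_right (le_abs_self M) (hp j).le
    linarith
  have hbox : ∀ α : Fin n → ℕ, ∑ j, ((α j : ℝ) + 1) / p j < M → ∀ j, α j < K := by
    intro α hα j
    have h1 := Finset.single_le_sum (f := fun j => ((α j : ℝ) + 1) / p j)
      (fun j _ => div_nonneg (by positivity) (hp j).le) (Finset.mem_univ j)
    have h2 := (div_lt_div_iff_of_pos_right (hp j)).1 ((h1.trans_lt hα).trans_le (hK j))
    exact_mod_cast lt_of_add_lt_add_right h2
  have hrest : (fun lam : ℝ => ∑ α : Fin n → Fin K,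
      if ∑ j, (((α j : ℕ) : ℝ) + 1) / p j < M then 0 else
        expansionTerm p sgn lam a (fun j => α j)) =O[atTop] fun lam : ℝ => lam ^ (-M) := by
    refine Asymptotics.IsBigO.fun_sum fun α _ => ?_
    split_ifs with h
    · exact Asymptotics.isBigO_zero _ _
    · exact expansionTerm_isBigO a (not_lt.1 h)
  refine ((orthantIntegral_sub_box_isBigO hp hsgn ha hR' hK).add hrest).congr_left fun lam => ?_
  rw [tsum_subtype_eq_sum_box hbox, sub_add, ← Finset.sum_sub_distrib]
  congr 1
  refine Finset.sum_congr rfl fun α _ => ?_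
  split_ifs <;> simp

/-- **Multivariable asymptotic expansion over the positive orthant for phases
`Σ_j ±_j x_j^{p_j}` with positive real exponents** (signs encoded by `sgn j = ±1`):
for every `N ≥ 1`,
`∫_{(0,∞)^n} e^{iλ Σ_j ±_j x_j^{p_j}} a(x) dx
  = Σ_{α ∈ Ω_p^N} ∏_j Ĩ^{±_j}_{p_j,α_j+1} · ∂^α a(0)/α! · λ^{-Σ_j (α_j+1)/p_j}
    + O(λ^{-(N+1-max_j(p_j-[p_j]))/max_j p_j})` as `λ → ∞`, where
`Ω_p^N = {α : Σ_j (α_j+1)/p_j < (N+1-max_j(p_j-[p_j]))/max_j p_j}` and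
`Ĩ^{±_j}_{p_j,α_j+1} = p_j⁻¹ e^{±_j iπ(α_j+1)/(2p_j)} Γ((α_j+1)/p_j)`. -/
theorem multivariable_expansion_real_powers (n : ℕ) (hn : 1 ≤ n)
    (p : Fin n → ℝ) (hp : ∀ j, 0 < p j)
    (sgn : Fin n → ℝ) (hsgn : ∀ j, sgn j = 1 ∨ sgn j = -1)
    (a : (Fin n → ℝ) → ℂ) (ha : ContDiff ℝ (⊤ : ℕ∞) a) (hsupp : HasCompactSupport a)
    (N : ℕ) (hN : 1 ≤ N) :
    (fun lam : ℝ =>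
      (∫ x in {x : Fin n → ℝ | ∀ j, 0 < x j},
        Complex.exp (Complex.I * lam *
          ((∑ j, sgn j * x j ^ p j : ℝ) : ℂ)) * a x) -
      ∑' α : {α : Fin n → ℕ //
          ∑ j, ((α j : ℝ) + 1) / p j <
            ((N : ℝ) + 1 - ⨆ j, (p j - (⌊p j⌋ : ℝ))) / ⨆ j, p j},
        (∏ j, ((p j : ℂ)⁻¹ *
            Complex.exp (sgn j * Complex.I *
              ((Real.pi * ((α.1 j : ℝ) + 1) / (2 * p j) : ℝ) : ℂ)) *
            Complex.Gamma ((((α.1 j : ℝ) + 1) / p j : ℝ) : ℂ))) *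
          (multiDeriv α.1 a 0 / (∏ j, (Nat.factorial (α.1 j) : ℂ))) *
          ((lam ^ (-∑ j, ((α.1 j : ℝ) + 1) / p j) : ℝ) : ℂ))
      =O[atTop] fun lam : ℝ =>
        lam ^ (-(((N : ℝ) + 1 - ⨆ j, (p j - (⌊p j⌋ : ℝ))) / ⨆ j, p j)) := by
  have h := orthantIntegral_sub_tsum_isBigO hp hsgn ha hsupp
    (((N : ℝ) + 1 - ⨆ j, (p j - (⌊p j⌋ : ℝ))) / ⨆ j, p j)
  simpa only [orthantIntegral, orthantMeasure_eq, oscFactor, expansionTerm, oscCoeff] using h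
end
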